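/- arXiv:1406.6335 — 2 statements merged into one kernel-verified Lean document; each statement's English description precedes it below -/
import Mathlib

section
/- Let E be a Riesz space with point separating order dual, write Z(E^~) = C(K) with K hyperstonian, let π ∈ C(K)'' be the idempotent with Z(E^{~~}) = π·C(K)'' and Ker(m) = (1−π)·C(K)'', and let p ∈ C(K)'' be the band projection onto C(K)_n' = C(K)_*. Then E^{~~} = (E^~)_n^~ (every order bounded functional on E^~ is order continuous) if and only if p = π. -/
noncomputable section

open Set

/-- A map between preordered sets is *order bounded* if it maps order intervals into
order intervals. -/
def IsOrdBdd {E F : Type*} [Preorder E] [Preorder F] (f : E → F) : Prop :=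
  ∀ a b : E, ∃ c d : F, ∀ x : E, a ≤ x → x ≤ b → c ≤ f x ∧ f x ≤ d

/-- A map of a Riesz space is *band preserving* if it preserves disjointness. -/
def IsBandPres {E : Type*} [Lattice E] [AddCommGroup E] (T : E → E) : Prop :=
  ∀ x y : E, |x| ⊓ |y| = 0 → |T x| ⊓ |y| = 0

/-- An *orthomorphism*: an order bounded, band preserving linear map. -/
def IsOrtho {E : Type*} [Lattice E] [AddCommGroup E] [Module ℝ E] (T : E → E) : Prop :=
  IsLinearMap ℝ T ∧ IsOrdBdd T ∧ IsBandPres T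

/-- A member of the *ideal center* `Z(E)`: an orthomorphism dominated by a multiple of the
identity. -/
def IsCentral {E : Type*} [Lattice E] [AddCommGroup E] [Module ℝ E] (T : E → E) : Prop :=
  IsOrtho T ∧ ∃ c : ℝ, ∀ x : E, 0 ≤ x → -(c • x) ≤ T x ∧ T x ≤ c • x

/-- Order continuity of a real functional: it converges to `0` along every downward
directed system with infimum `0`. -/
def IsOrderContinuousFun {X : Type*} [Lattice X] [AddCommGroup X] (φ : X → ℝ) : Prop :=
  ∀ s : Set X, s.Nonempty → DirectedOn (· ≥ ·) s → IsGLB s 0 →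
    ∀ ε : ℝ, 0 < ε → ∃ x ∈ s, ∀ y ∈ s, y ≤ x → |φ y| < ε

/-- `p` realizes the Riesz space `D` as the order dual `E^∼` of `E`. -/
structure IsOrderDual (E D : Type*) [Lattice E] [AddCommGroup E] [Module ℝ E]
    [Lattice D] [AddCommGroup D] [Module ℝ D] (p : D → E → ℝ) : Prop where
  lin_fun : ∀ f : D, IsLinearMap ℝ (p f)
  lin_vec : ∀ x : E, IsLinearMap ℝ fun f => p f x
  bdd : ∀ f : D, IsOrdBdd (p f)
  inj : ∀ f g : D, (∀ x, p f x = p g x) → f = g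
  surj : ∀ φ : E → ℝ, IsLinearMap ℝ φ → IsOrdBdd φ → ∃ f : D, ∀ x, p f x = φ x
  le_iff : ∀ f g : D, f ≤ g ↔ ∀ x : E, 0 ≤ x → p f x ≤ p g x

/-- `p` realizes the Riesz space `B` as the order continuous order dual `(X^∼)ₙ` of `X`
(used for `X = A^∼`, giving `B = (A^∼)ₙ^∼`). -/
structure IsOrderContinuousDual (X B : Type*) [Lattice X] [AddCommGroup X] [Module ℝ X]
    [Lattice B] [AddCommGroup B] [Module ℝ B] (p : B → X → ℝ) : Prop where
  lin_fun : ∀ F : B, IsLinearMap ℝ (p F)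
  lin_vec : ∀ f : X, IsLinearMap ℝ fun F => p F f
  bdd : ∀ F : B, IsOrdBdd (p F)
  cont : ∀ F : B, IsOrderContinuousFun (p F)
  inj : ∀ F G : B, (∀ f, p F f = p G f) → F = G
  surj : ∀ φ : X → ℝ, IsLinearMap ℝ φ → IsOrdBdd φ → IsOrderContinuousFun φ →
    ∃ F : B, ∀ f, p F f = φ f
  le_iff : ∀ F G : B, F ≤ G ↔ ∀ f : X, 0 ≤ f → p F f ≤ p G f

/-- `ρ` realizes the lattice-ordered algebra `O` as the `f`-algebra `Orth(E)` of all
orthomorphisms of `E`. -/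
structure IsOrthAlg (E O : Type*) [Lattice E] [AddCommGroup E] [Module ℝ E]
    [Lattice O] [Ring O] [Module ℝ O] (ρ : O → E → E) : Prop where
  ortho : ∀ a : O, IsOrtho (ρ a)
  lin_vec : ∀ x : E, IsLinearMap ℝ fun a => ρ a x
  map_one : ∀ x : E, ρ 1 x = x
  map_mul : ∀ (a b : O) (x : E), ρ (a * b) x = ρ a (ρ b x)
  inj : ∀ a b : O, (∀ x, ρ a x = ρ b x) → a = b
  surj : ∀ T : E → E, IsOrtho T → ∃ a : O, ∀ x, ρ a x = T x
  le_iff : ∀ a b : O, a ≤ b ↔ ∀ x : E, 0 ≤ x → ρ a x ≤ ρ b x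

/-- `ρ` realizes the normed lattice-ordered algebra `Z` as the ideal center `Z(E)` of `E`,
an AM-space whose norm is the order unit norm (the order/algebra unit being `id`). -/
structure IsCenterOf (E Z : Type*) [Lattice E] [AddCommGroup E] [Module ℝ E]
    [Lattice Z] [NormedRing Z] [NormedAlgebra ℝ Z] (ρ : Z → E → E) : Prop where
  central : ∀ a : Z, IsCentral (ρ a)
  lin_vec : ∀ x : E, IsLinearMap ℝ fun a => ρ a x
  map_one : ∀ x : E, ρ 1 x = x
  map_mul : ∀ (a b : Z) (x : E), ρ (a * b) x = ρ a (ρ b x)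
  inj : ∀ a b : Z, (∀ x, ρ a x = ρ b x) → a = b
  surj : ∀ T : E → E, IsCentral T → ∃ a : Z, ∀ x, ρ a x = T x
  le_iff : ∀ a b : Z, a ≤ b ↔ ∀ x : E, 0 ≤ x → ρ a x ≤ ρ b x
  norm_le_iff : ∀ (a : Z) (c : ℝ), 0 ≤ c →
    (‖a‖ ≤ c ↔ ∀ x : E, 0 ≤ x → -(c • x) ≤ ρ a x ∧ ρ a x ≤ c • x)

/-- The pairing `p : D → E → ℝ` separates the points of `E`. -/
def SepPoints {E D : Type*} [Zero E] (p : D → E → ℝ) : Prop :=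
  ∀ x : E, (∀ f : D, p f x = 0) → x = 0

/-- `y` belongs to the `σ(E,D)`-closure of `s ⊆ E`, for the pairing `p : D → E → ℝ`. -/
def InWeakClosure {E D : Type*} (p : D → E → ℝ) (s : Set E) (y : E) : Prop :=
  ∀ (fs : Finset D) (ε : ℝ), 0 < ε → ∃ z ∈ s, ∀ f ∈ fs, |p f z - p f y| < ε

/-- `E` has a *topologically full center*: for each `x ∈ E₊` the `σ(E,E^∼)`-closure of
`Z(E)x` contains the order ideal generated by `x`.  Here `p : D → E → ℝ` is the duality
with `E^∼` and `ρ : Z → E → E` is the action of the ideal center. -/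
def TopFullCenter {E D Z : Type*} [Lattice E] [AddCommGroup E] [Module ℝ E]
    (p : D → E → ℝ) (ρ : Z → E → E) : Prop :=
  ∀ x : E, 0 ≤ x → ∀ y : E, (∃ c : ℝ, 0 ≤ c ∧ |y| ≤ c • x) →
    InWeakClosure p {z | ∃ T : Z, ρ T x = z} y

/-- `FG` is the Arens product `F ⬝ G` in the order bidual `B` of the algebra `A`:
`(F⬝G)(f) = F(G⬝f)`, `(G⬝f)(a) = G(f⬝a)`, `(f⬝a)(b) = f(ab)`; `pA : DA → A → ℝ` is the
duality of `A` with `A^∼` and `pB : B → DA → ℝ` that of `(A^∼)ₙ^∼` with `A^∼`. -/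
def IsArensProduct {A DA B : Type*} [Mul A] (pA : DA → A → ℝ) (pB : B → DA → ℝ)
    (F G FG : B) : Prop :=
  ∀ f Gf : DA,
    (∀ (a : A) (fa : DA), (∀ b : A, pA fa b = pA f (a * b)) → pA Gf a = pB G fa) →
    pB FG f = pB F Gf

/-- The ring structure of `B` is the Arens multiplication inherited from `A`, with unit the
canonical image of `1 ∈ A`. -/
structure IsArensAlgebra {A DA B : Type*} [Monoid A] [Ring B]
    (pA : DA → A → ℝ) (pB : B → DA → ℝ) : Prop where
  mul_def : ∀ F G : B, IsArensProduct pA pB F G (F * G)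
  one_def : ∀ f : DA, pB 1 f = pA f 1

section NormedArens

variable (Z : Type*) [NormedRing Z] [NormedAlgebra ℝ Z]

/-- First step of the Arens construction: `f ⬝ a` for `f ∈ Z'`, `a ∈ Z`:
`(f⬝a)(b) = f(ab)`. -/
def arensDot (f : Z →L[ℝ] ℝ) (a : Z) : Z →L[ℝ] ℝ :=
  f.comp (ContinuousLinearMap.mul ℝ Z a)

/-- `a ↦ f ⬝ a` as a continuous linear map. -/
def arensDotL (f : Z →L[ℝ] ℝ) : Z →L[ℝ] Z →L[ℝ] ℝ :=
  (ContinuousLinearMap.compL ℝ Z Z ℝ f).comp (ContinuousLinearMap.mul ℝ Z)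

/-- Second step of the Arens construction: `F ⬝ f` for `F ∈ Z''`, `f ∈ Z'`:
`(F⬝f)(a) = F(f⬝a)`. -/
def arensFDot (F : (Z →L[ℝ] ℝ) →L[ℝ] ℝ) (f : Z →L[ℝ] ℝ) : Z →L[ℝ] ℝ :=
  F.comp (arensDotL Z f)

/-- `f ↦ f ⬝ ·` as a continuous linear map. -/
def arensDotLL : (Z →L[ℝ] ℝ) →L[ℝ] Z →L[ℝ] Z →L[ℝ] ℝ :=
  ((ContinuousLinearMap.compL ℝ Z (Z →L[ℝ] Z) (Z →L[ℝ] ℝ)).flip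
      (ContinuousLinearMap.mul ℝ Z)).comp (ContinuousLinearMap.compL ℝ Z Z ℝ)

/-- `f ↦ F ⬝ f` as a continuous linear map. -/
def arensFDotL (F : (Z →L[ℝ] ℝ) →L[ℝ] ℝ) : (Z →L[ℝ] ℝ) →L[ℝ] Z →L[ℝ] ℝ :=
  (ContinuousLinearMap.compL ℝ Z (Z →L[ℝ] ℝ) ℝ F).comp (arensDotLL Z)

/-- The *Arens product* on the norm bidual `Z''`: `(F⬝G)(f) = F(G⬝f)`. -/
def arensMul (F G : (Z →L[ℝ] ℝ) →L[ℝ] ℝ) : (Z →L[ℝ] ℝ) →L[ℝ] ℝ :=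
  F.comp (arensFDotL Z G)

/-- The canonical image of `1 ∈ Z` in the bidual `Z''`; it is the unit for the Arens
product. -/
def arensOne : (Z →L[ℝ] ℝ) →L[ℝ] ℝ := ContinuousLinearMap.apply ℝ ℝ (1 : Z)

end NormedArens

section DualOrder

variable {Z : Type*} [Lattice Z] [NormedRing Z] [NormedAlgebra ℝ Z]

/-- Positivity of a functional in `Z'`. -/
def dualNonneg (μ : Z →L[ℝ] ℝ) : Prop := ∀ a : Z, 0 ≤ a → 0 ≤ μ a

/-- The canonical order of the bidual `Z''`. -/
def bidualLe (F G : (Z →L[ℝ] ℝ) →L[ℝ] ℝ) : Prop :=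
  ∀ μ : Z →L[ℝ] ℝ, dualNonneg μ → F μ ≤ G μ

/-- `H = F ⊔ G` in the bidual `Z''`. -/
def IsBidualSup (F G H : (Z →L[ℝ] ℝ) →L[ℝ] ℝ) : Prop :=
  bidualLe F H ∧ bidualLe G H ∧
    ∀ K : (Z →L[ℝ] ℝ) →L[ℝ] ℝ, bidualLe F K → bidualLe G K → bidualLe H K

/-- `s ⊆ Z''` is downward directed with infimum `0`. -/
def BidualDownTo0 (s : Set ((Z →L[ℝ] ℝ) →L[ℝ] ℝ)) : Prop :=
  s.Nonempty ∧ (∀ F ∈ s, ∀ G ∈ s, ∃ H ∈ s, bidualLe H F ∧ bidualLe H G) ∧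
    (∀ F ∈ s, bidualLe 0 F) ∧ ∀ K, (∀ F ∈ s, bidualLe K F) → bidualLe K 0

/-- The Riesz–Kantorovich formula for `|μ|(a)`, `μ ∈ Z'`, `a ∈ Z₊`. -/
def dualAbs (μ : Z →L[ℝ] ℝ) (a : Z) : ℝ := sSup ((fun b => μ b) '' {b : Z | |b| ≤ a})

/-- Disjointness `|μ| ⊓ |ν| = 0` in `Z'`. -/
def DualDisjoint (μ ν : Z →L[ℝ] ℝ) : Prop :=
  ∀ a : Z, 0 ≤ a → ∀ ε : ℝ, 0 < ε →
    ∃ b c : Z, 0 ≤ b ∧ 0 ≤ c ∧ b + c = a ∧ dualAbs μ b + dualAbs ν c < ε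

/-- The Riesz–Kantorovich formula for `|F|(μ)`, `F ∈ Z''`, `μ ∈ Z'₊`. -/
def bidualAbs (F : (Z →L[ℝ] ℝ) →L[ℝ] ℝ) (μ : Z →L[ℝ] ℝ) : ℝ :=
  sSup ((fun ν => F ν) '' {ν : Z →L[ℝ] ℝ | ∀ a : Z, 0 ≤ a → dualAbs ν a ≤ μ a})

/-- Disjointness `|F| ⊓ |G| = 0` in `Z''`. -/
def BidualDisjoint (F G : (Z →L[ℝ] ℝ) →L[ℝ] ℝ) : Prop :=
  ∀ μ : Z →L[ℝ] ℝ, dualNonneg μ → ∀ ε : ℝ, 0 < ε →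
    ∃ μ₁ μ₂ : Z →L[ℝ] ℝ, dualNonneg μ₁ ∧ dualNonneg μ₂ ∧ μ₁ + μ₂ = μ ∧
      bidualAbs F μ₁ + bidualAbs G μ₂ < ε

end DualOrder

/-- A member of the ideal center `Z(J)` of an order ideal `J` of a Riesz space, encoded as a
map defined on the ambient space whose restriction to `J` is the actual operator. -/
def IsCentralOn {D : Type*} [Lattice D] [AddCommGroup D] [Module ℝ D]
    (J : Set D) (S : D → D) : Prop :=
  (∀ f ∈ J, S f ∈ J) ∧ (∀ f ∈ J, ∀ g ∈ J, S (f + g) = S f + S g) ∧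
    (∀ (c : ℝ), ∀ f ∈ J, S (c • f) = c • S f) ∧
    ∃ c : ℝ, ∀ f ∈ J, 0 ≤ f → -(c • f) ≤ S f ∧ S f ≤ c • f

end

theorem posPart_smul_of_pos {V : Type*} [Lattice V] [AddCommGroup V] [Module ℝ V]
    [PosSMulMono ℝ V] {c : ℝ} (hc : 0 < c) (x : V) : (c • x)⁺ = c • x⁺ := by
  apply le_antisymm
  · exact sup_le (smul_le_smul_of_nonneg_left (le_posPart x) hc.le)
      (smul_nonneg hc.le (posPart_nonneg _))
  · have h : x⁺ ≤ c⁻¹ • (c • x)⁺ := by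
      refine sup_le ?_ (smul_nonneg (inv_nonneg.2 hc.le) (posPart_nonneg _))
      have := smul_le_smul_of_nonneg_left (le_posPart (c • x)) (inv_nonneg.2 hc.le)
      rwa [inv_smul_smul₀ hc.ne'] at this
    have := smul_le_smul_of_nonneg_left h hc.le
    rwa [smul_inv_smul₀ hc.ne'] at this

section PositiveLinearMap

variable {V W : Type*} [Lattice V] [AddCommGroup V] [IsOrderedAddMonoid V] [Module ℝ V]
  [Lattice W] [AddCommGroup W] [IsOrderedAddMonoid W] [Module ℝ W]

theorem LinearMap.monotone_of_nonneg (T : V →ₗ[ℝ] W) (hT : ∀ x, 0 ≤ x → 0 ≤ T x) :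
    Monotone T := by
  intro x y hxy
  have := hT (y - x) (sub_nonneg.2 hxy)
  rwa [map_sub, sub_nonneg] at this

theorem LinearMap.abs_map_le_of_nonneg (T : V →ₗ[ℝ] W) (hT : ∀ x, 0 ≤ x → 0 ≤ T x) (x : V) :
    |T x| ≤ T |x| := by
  apply abs_le'.2
  refine ⟨T.monotone_of_nonneg hT (le_abs_self x), ?_⟩
  rw [← map_neg]
  exact T.monotone_of_nonneg hT (neg_le_abs x)

end PositiveLinearMap

section OrderedModule

variable {V : Type*} [Lattice V] [AddCommGroup V] [IsOrderedAddMonoid V] [Module ℝ V]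
  [PosSMulMono ℝ V]

/-- A map additive and positively homogeneous on the positive cone extends to a linear map. -/
theorem exists_linearMap_eqOn_nonneg {W : Type*} [AddCommGroup W] [Module ℝ W] (τ : V → W)
    (hadd : ∀ x y, 0 ≤ x → 0 ≤ y → τ (x + y) = τ x + τ y)
    (hsmul : ∀ (c : ℝ) x, 0 < c → 0 ≤ x → τ (c • x) = c • τ x) :
    ∃ T : V →ₗ[ℝ] W, ∀ x, 0 ≤ x → T x = τ x := by
  have key : ∀ x y, 0 ≤ x → 0 ≤ y → τ (x - y)⁺ - τ (x - y)⁻ = τ x - τ y := by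
    intro x y hx hy
    have h1 : (x - y)⁺ + y = x + (x - y)⁻ := by
      have := posPart_sub_negPart (x - y)
      rw [sub_eq_sub_iff_add_eq_add] at this
      exact this
    have h2 := congrArg τ h1
    rw [hadd _ _ (posPart_nonneg _) hy, hadd _ _ hx (negPart_nonneg _)] at h2
    rw [sub_eq_sub_iff_add_eq_add, h2]
  have hzero : τ 0 = 0 := by
    have := hadd 0 0 le_rfl le_rfl
    simpa using this
  have hT_add : ∀ x y, τ (x + y)⁺ - τ (x + y)⁻ = (τ x⁺ - τ x⁻) + (τ y⁺ - τ y⁻) := by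
    intro x y
    have h := key (x⁺ + y⁺) (x⁻ + y⁻) (add_nonneg (posPart_nonneg _) (posPart_nonneg _))
      (add_nonneg (negPart_nonneg _) (negPart_nonneg _))
    have e : x⁺ + y⁺ - (x⁻ + y⁻) = x + y := by
      rw [add_sub_add_comm, posPart_sub_negPart, posPart_sub_negPart]
    rw [e, hadd _ _ (posPart_nonneg _) (posPart_nonneg _),
      hadd _ _ (negPart_nonneg _) (negPart_nonneg _)] at h
    rw [h]; abel
  have hT_pos : ∀ (c : ℝ) x, 0 < c → τ (c • x)⁺ - τ (c • x)⁻ = c • (τ x⁺ - τ x⁻) := by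
    intro c x hc
    have h := key (c • x⁺) (c • x⁻) (smul_nonneg hc.le (posPart_nonneg _))
      (smul_nonneg hc.le (negPart_nonneg _))
    rw [← smul_sub, posPart_sub_negPart, hsmul _ _ hc (posPart_nonneg _),
      hsmul _ _ hc (negPart_nonneg _)] at h
    rw [h, smul_sub]
  have hT_neg : ∀ x, τ (-x)⁺ - τ (-x)⁻ = -(τ x⁺ - τ x⁻) := by
    intro x
    rw [posPart_neg, negPart_neg]; abel
  refine ⟨⟨⟨fun x => τ x⁺ - τ x⁻, hT_add⟩, ?_⟩, ?_⟩
  · intro c x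
    rcases lt_trichotomy c 0 with hc | rfl | hc
    · have := hT_pos (-c) (-x) (by linarith)
      rw [neg_smul_neg, hT_neg, neg_smul_neg] at this
      exact this
    · simp
    · exact hT_pos c x hc
  · intro x hx
    change τ x⁺ - τ x⁻ = τ x
    rw [posPart_of_nonneg hx, negPart_of_nonneg hx, hzero, sub_zero]

theorem smul_inf_eq_zero_of_inf_eq_zero {a b : V} {c : ℝ} (hc : 0 ≤ c) (h : a ⊓ b = 0) :
    (c • a) ⊓ b = 0 := by
  have ha : 0 ≤ a := h ▸ inf_le_left
  have hb : 0 ≤ b := h ▸ inf_le_right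
  have hd : 0 < c + 1 := by linarith
  apply le_antisymm _ (le_inf (smul_nonneg hc ha) hb)
  have h1 : (c + 1)⁻¹ • ((c • a) ⊓ b) ≤ 0 := by
    rw [← h]
    apply le_inf
    · have : (c • a) ⊓ b ≤ (c + 1) • a :=
        inf_le_left.trans (smul_le_smul_of_nonneg_right (by linarith) ha)
      have := smul_le_smul_of_nonneg_left this (inv_nonneg.2 hd.le)
      rwa [inv_smul_smul₀ hd.ne'] at this
    · have : (c • a) ⊓ b ≤ (c + 1) • b := by
        refine inf_le_right.trans ?_
        have := smul_le_smul_of_nonneg_right (show (1 : ℝ) ≤ c + 1 by linarith) hb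
        rwa [one_smul] at this
      have := smul_le_smul_of_nonneg_left this (inv_nonneg.2 hd.le)
      rwa [inv_smul_smul₀ hd.ne'] at this
  have := smul_le_smul_of_nonneg_left h1 hd.le
  rwa [smul_inv_smul₀ hd.ne', smul_zero] at this

theorem isCentral_of_nonneg_of_le (T : V →ₗ[ℝ] V) {c : ℝ} (hc : 0 ≤ c)
    (h0 : ∀ x, 0 ≤ x → 0 ≤ T x) (h1 : ∀ x, 0 ≤ x → T x ≤ c • x) : IsCentral T := by
  refine ⟨⟨T.isLinear, ?_, ?_⟩, c, ?_⟩
  · intro a b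
    exact ⟨T a, T b, fun x hax hxb =>
      ⟨T.monotone_of_nonneg h0 hax, T.monotone_of_nonneg h0 hxb⟩⟩
  · intro x y hxy
    apply le_antisymm _ (le_inf (abs_nonneg _) (abs_nonneg _))
    rw [← smul_inf_eq_zero_of_inf_eq_zero hc hxy]
    exact inf_le_inf_right _ ((T.abs_map_le_of_nonneg h0 x).trans (h1 _ (abs_nonneg _)))
  · intro x hx
    exact ⟨(neg_nonpos.2 (smul_nonneg hc hx)).trans (h0 x hx), h1 x hx⟩

end OrderedModule

namespace IsOrderDual

variable {E D : Type*} [Lattice E] [AddCommGroup E] [Module ℝ E]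
  [Lattice D] [AddCommGroup D] [Module ℝ D] {pE : D → E → ℝ}

theorem map_add_right (hD : IsOrderDual E D pE) (f : D) (x y : E) :
    pE f (x + y) = pE f x + pE f y := (hD.lin_fun f).map_add x y

theorem map_sub_right (hD : IsOrderDual E D pE) (f : D) (x y : E) :
    pE f (x - y) = pE f x - pE f y := (hD.lin_fun f).map_sub x y

theorem map_smul_right (hD : IsOrderDual E D pE) (f : D) (c : ℝ) (x : E) :
    pE f (c • x) = c * pE f x := (hD.lin_fun f).map_smul c x

theorem map_add_left (hD : IsOrderDual E D pE) (f g : D) (x : E) :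
    pE (f + g) x = pE f x + pE g x := (hD.lin_vec x).map_add f g

theorem map_sub_left (hD : IsOrderDual E D pE) (f g : D) (x : E) :
    pE (f - g) x = pE f x - pE g x := (hD.lin_vec x).map_sub f g

theorem map_neg_left (hD : IsOrderDual E D pE) (f : D) (x : E) :
    pE (-f) x = -pE f x := (hD.lin_vec x).map_neg f

theorem map_zero_left (hD : IsOrderDual E D pE) (x : E) : pE 0 x = 0 :=
  (hD.lin_vec x).map_zero

theorem map_zero_right (hD : IsOrderDual E D pE) (f : D) : pE f 0 = 0 :=
  (hD.lin_fun f).map_zero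

theorem nonneg (hD : IsOrderDual E D pE) {f : D} {x : E} (hf : 0 ≤ f) (hx : 0 ≤ x) :
    0 ≤ pE f x := by
  simpa [hD.map_zero_left] using (hD.le_iff 0 f).1 hf x hx

variable [IsOrderedAddMonoid E]

theorem mono_right (hD : IsOrderDual E D pE) {f : D} {x y : E} (hf : 0 ≤ f) (hxy : x ≤ y) :
    pE f x ≤ pE f y := by
  have := hD.nonneg hf (sub_nonneg.2 hxy)
  rw [hD.map_sub_right] at this
  linarith

theorem abs_le (hD : IsOrderDual E D pE) (f : D) (x : E) : |pE f x| ≤ pE |f| |x| := by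
  have h1 := fun y (hy : 0 ≤ y) => (hD.le_iff f |f|).1 (le_abs_self f) y hy
  have h2 := fun y (hy : 0 ≤ y) => (hD.le_iff (-f) |f|).1 (neg_le_abs f) y hy
  have h3 := h1 _ (posPart_nonneg x)
  have h4 := h1 _ (negPart_nonneg x)
  have h5 := h2 _ (posPart_nonneg x)
  have h6 := h2 _ (negPart_nonneg x)
  rw [hD.map_neg_left] at h5 h6
  have e1 : pE f x = pE f x⁺ - pE f x⁻ := by
    rw [← hD.map_sub_right, posPart_sub_negPart]
  rw [← posPart_add_negPart x, hD.map_add_right, e1, _root_.abs_le]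
  constructor <;> linarith

/-- A positive linear functional is represented by a positive element of the order dual. -/
theorem exists_of_nonneg (hD : IsOrderDual E D pE) (φ : E →ₗ[ℝ] ℝ)
    (hφ : ∀ x, 0 ≤ x → 0 ≤ φ x) : ∃ f : D, 0 ≤ f ∧ ∀ x, pE f x = φ x := by
  obtain ⟨f, hf⟩ := hD.surj φ φ.isLinear fun a b =>
    ⟨φ a, φ b, fun x hax hxb => ⟨φ.monotone_of_nonneg hφ hax, φ.monotone_of_nonneg hφ hxb⟩⟩
  refine ⟨f, (hD.le_iff _ _).2 fun x hx => ?_, hf⟩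
  rw [hD.map_zero_left, hf]
  exact hφ x hx

variable [PosSMulMono ℝ E]

/-- The order dual is Dedekind complete, for decreasing positive nets. -/
theorem exists_isGLB_range (hD : IsOrderDual E D pE) {ι : Type*} [Preorder ι] [Nonempty ι]
    [IsDirectedOrder ι] (a : ι → D) (ha : Antitone a) (h0 : ∀ i, 0 ≤ a i) :
    ∃ d, IsGLB (Set.range a) d := by
  have hlim : ∀ x : E, 0 ≤ x →
      Filter.Tendsto (fun i => pE (a i) x) Filter.atTop (nhds (⨅ i, pE (a i) x)) := by
    intro x hx
    refine tendsto_atTop_ciInf (fun i j hij => (hD.le_iff _ _).1 (ha hij) x hx) ⟨0, ?_⟩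
    rintro _ ⟨i, rfl⟩
    exact hD.nonneg (h0 i) hx
  obtain ⟨φ, hφ⟩ := exists_linearMap_eqOn_nonneg (fun x => ⨅ i, pE (a i) x)
    (by
      intro x y hx hy
      refine tendsto_nhds_unique (hlim _ (add_nonneg hx hy)) ?_
      simpa only [hD.map_add_right] using (hlim x hx).add (hlim y hy))
    (by
      intro c x hc hx
      refine tendsto_nhds_unique (hlim _ (smul_nonneg hc.le hx)) ?_
      simpa only [hD.map_smul_right, smul_eq_mul] using (hlim x hx).const_mul c)
  obtain ⟨d, hd0, hd⟩ := hD.exists_of_nonneg φ fun x hx => by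
    rw [hφ x hx]
    exact Real.iInf_nonneg fun i => hD.nonneg (h0 i) hx
  refine ⟨d, ?_, ?_⟩
  · rintro _ ⟨i, rfl⟩
    refine (hD.le_iff _ _).2 fun x hx => ?_
    rw [hd, hφ x hx]
    refine ciInf_le ⟨0, ?_⟩ i
    rintro _ ⟨j, rfl⟩
    exact hD.nonneg (h0 j) hx
  · intro b hb
    refine (hD.le_iff _ _).2 fun x hx => ?_
    rw [hd, hφ x hx]
    exact le_ciInf fun i => (hD.le_iff _ _).1 (hb ⟨i, rfl⟩) x hx

end IsOrderDual

/-- `Θ` realizes `C(K, ℝ)` as the ideal center of the Riesz space `D`, as a unital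
lattice-ordered algebra. -/
structure IsCenterRep {D K : Type*} [Lattice D] [AddCommGroup D] [Module ℝ D]
    [TopologicalSpace K] [CompactSpace K] (Θ : C(K, ℝ) → D → D) : Prop where
  add : ∀ h h' : C(K, ℝ), Θ (h + h') = Θ h + Θ h'
  smul : ∀ (c : ℝ) (h : C(K, ℝ)), Θ (c • h) = c • Θ h
  mul : ∀ (h h' : C(K, ℝ)) (f : D), Θ (h * h') f = Θ h (Θ h' f)
  one : ∀ f : D, Θ 1 f = f
  inj : Function.Injective Θ
  central : ∀ h : C(K, ℝ), IsCentral (Θ h)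
  surj : ∀ S : D → D, IsCentral S → ∃ h : C(K, ℝ), Θ h = S
  sup : ∀ (h h' : C(K, ℝ)) (f : D), 0 ≤ f → Θ (h ⊔ h') f = Θ h f ⊔ Θ h' f

namespace IsCenterRep

variable {D K : Type*} [Lattice D] [AddCommGroup D] [Module ℝ D]
  [TopologicalSpace K] [CompactSpace K] {Θ : C(K, ℝ) → D → D}

theorem add_apply (hΘ : IsCenterRep Θ) (h h' : C(K, ℝ)) (f : D) :
    Θ (h + h') f = Θ h f + Θ h' f := by rw [hΘ.add]; rfl

theorem smul_apply (hΘ : IsCenterRep Θ) (c : ℝ) (h : C(K, ℝ)) (f : D) :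
    Θ (c • h) f = c • Θ h f := by rw [hΘ.smul]; rfl

theorem zero_apply (hΘ : IsCenterRep Θ) (f : D) : Θ 0 f = 0 := by
  simpa using hΘ.smul_apply 0 0 f

theorem neg_apply (hΘ : IsCenterRep Θ) (h : C(K, ℝ)) (f : D) : Θ (-h) f = -Θ h f := by
  simpa using hΘ.smul_apply (-1) h f

theorem sub_apply (hΘ : IsCenterRep Θ) (h h' : C(K, ℝ)) (f : D) :
    Θ (h - h') f = Θ h f - Θ h' f := by
  rw [sub_eq_add_neg, hΘ.add_apply, hΘ.neg_apply, sub_eq_add_neg]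

theorem isLinearMap (hΘ : IsCenterRep Θ) (h : C(K, ℝ)) : IsLinearMap ℝ (Θ h) :=
  (hΘ.central h).1.1

theorem nonneg (hΘ : IsCenterRep Θ) {h : C(K, ℝ)} {f : D} (hh : 0 ≤ h) (hf : 0 ≤ f) :
    0 ≤ Θ h f := by
  have := hΘ.sup h 0 f hf
  rw [sup_of_le_left hh, hΘ.zero_apply] at this
  rw [this]
  exact le_sup_right

theorem abs_apply (hΘ : IsCenterRep Θ) (h : C(K, ℝ)) {f : D} (hf : 0 ≤ f) :
    Θ |h| f = |Θ h f| := by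
  change Θ (h ⊔ -h) f = Θ h f ⊔ -Θ h f
  rw [hΘ.sup _ _ _ hf, hΘ.neg_apply]

variable [IsOrderedAddMonoid D]

theorem mono_left (hΘ : IsCenterRep Θ) {h h' : C(K, ℝ)} {f : D} (hh : h ≤ h') (hf : 0 ≤ f) :
    Θ h f ≤ Θ h' f := by
  have := hΘ.nonneg (sub_nonneg.2 hh) hf
  rwa [hΘ.sub_apply, sub_nonneg] at this

theorem mono_right (hΘ : IsCenterRep Θ) {h : C(K, ℝ)} {f g : D} (hh : 0 ≤ h) (hfg : f ≤ g) :
    Θ h f ≤ Θ h g := by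
  have := hΘ.nonneg hh (sub_nonneg.2 hfg)
  rwa [(hΘ.isLinearMap h).map_sub, sub_nonneg] at this

theorem eq_of_forall_nonneg (hΘ : IsCenterRep Θ) {h h' : C(K, ℝ)}
    (H : ∀ f : D, 0 ≤ f → Θ h f = Θ h' f) : h = h' := by
  apply hΘ.inj
  funext f
  rw [← posPart_sub_negPart f, (hΘ.isLinearMap h).map_sub, (hΘ.isLinearMap h').map_sub,
    H _ (posPart_nonneg _), H _ (negPart_nonneg _)]

theorem le_iff (hΘ : IsCenterRep Θ) (h h' : C(K, ℝ)) :
    h ≤ h' ↔ ∀ f : D, 0 ≤ f → Θ h f ≤ Θ h' f := by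
  refine ⟨fun hh f hf => hΘ.mono_left hh hf, fun H => ?_⟩
  rw [← sup_eq_right]
  apply hΘ.eq_of_forall_nonneg
  intro f hf
  rw [hΘ.sup _ _ _ hf, sup_of_le_right (H f hf)]

theorem abs_apply_le (hΘ : IsCenterRep Θ) (h : C(K, ℝ)) (f : D) : |Θ h f| ≤ ‖h‖ • |f| := by
  have key : ∀ f : D, 0 ≤ f → |Θ h f| ≤ ‖h‖ • f := by
    intro f hf
    rw [← hΘ.abs_apply h hf]
    have : |h| ≤ ‖h‖ • (1 : C(K, ℝ)) := by
      intro t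
      simpa using h.norm_coe_le_norm t
    simpa [hΘ.smul_apply, hΘ.one] using hΘ.mono_left this hf
  have h1 := key _ (posPart_nonneg f)
  have h2 := key _ (negPart_nonneg f)
  calc |Θ h f| = |Θ h f⁺ + -Θ h f⁻| := by
        rw [← sub_eq_add_neg, ← (hΘ.isLinearMap h).map_sub, posPart_sub_negPart]
    _ ≤ |Θ h f⁺| + |Θ h f⁻| := by
        refine (abs_add_le _ _).trans ?_
        rw [abs_neg]
    _ ≤ ‖h‖ • f⁺ + ‖h‖ • f⁻ := add_le_add h1 h2
    _ = ‖h‖ • |f| := by rw [← smul_add, posPart_add_negPart]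

variable [PosSMulMono ℝ D] {E : Type*} [Lattice E] [AddCommGroup E] [IsOrderedAddMonoid E]
  [Module ℝ E] [PosSMulMono ℝ E] {pE : D → E → ℝ}

/-- A decreasing net of asymptotically linear positive maps has an infimum in the center. -/
theorem exists_isGLB_range (hΘ : IsCenterRep Θ) (hD : IsOrderDual E D pE) {ι : Type*}
    [Preorder ι] [Nonempty ι] [IsDirectedOrder ι] (τ : ι → D → D)
    (hanti : ∀ f, 0 ≤ f → Antitone fun i => τ i f)
    (hpos : ∀ i f, 0 ≤ f → 0 ≤ τ i f)
    (hbdd : ∃ (i : ι) (c : ℝ), 0 ≤ c ∧ ∀ f, 0 ≤ f → τ i f ≤ c • f)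
    (hadd₁ : ∀ i f g, 0 ≤ f → 0 ≤ g → ∃ j, τ j (f + g) ≤ τ i f + τ i g)
    (hadd₂ : ∀ i f g, 0 ≤ f → 0 ≤ g → ∃ j, τ j f + τ j g ≤ τ i (f + g))
    (hsmul : ∀ i (c : ℝ) f, 0 < c → 0 ≤ f → ∃ j, τ j (c • f) ≤ c • τ i f) :
    ∃ e : C(K, ℝ), ∀ f, 0 ≤ f → IsGLB (Set.range fun i => τ i f) (Θ e f) := by
  have hex : ∀ f, ∃ d, 0 ≤ f → IsGLB (Set.range fun i => τ i f) d := by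
    intro f
    by_cases hf : 0 ≤ f
    · obtain ⟨d, hd⟩ := hD.exists_isGLB_range (fun i => τ i f) (hanti f hf) fun i => hpos i f hf
      exact ⟨d, fun _ => hd⟩
    · exact ⟨0, fun h => absurd h hf⟩
  choose T₀ hT₀ using hex
  have hle : ∀ i f, 0 ≤ f → T₀ f ≤ τ i f := fun i f hf => (hT₀ f hf).1 ⟨i, rfl⟩
  have hge : ∀ f d, 0 ≤ f → (∀ i, d ≤ τ i f) → d ≤ T₀ f := by
    intro f d hf h
    apply (hT₀ f hf).2
    rintro _ ⟨i, rfl⟩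
    exact h i
  have hscale : ∀ (c : ℝ) f, 0 < c → 0 ≤ f → T₀ (c • f) ≤ c • T₀ f := by
    intro c f hc hf
    have : c⁻¹ • T₀ (c • f) ≤ T₀ f := by
      refine hge f _ hf fun i => ?_
      obtain ⟨j, hj⟩ := hsmul i c f hc hf
      have := smul_le_smul_of_nonneg_left ((hle j _ (smul_nonneg hc.le hf)).trans hj)
        (inv_nonneg.2 hc.le)
      rwa [inv_smul_smul₀ hc.ne'] at this
    have := smul_le_smul_of_nonneg_left this hc.le
    rwa [smul_inv_smul₀ hc.ne'] at this
  obtain ⟨T, hT⟩ := exists_linearMap_eqOn_nonneg T₀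
    (by
      intro f g hf hg
      apply le_antisymm
      · rw [← sub_le_iff_le_add]
        refine hge f _ hf fun i => ?_
        rw [sub_le_iff_le_add, ← sub_le_iff_le_add']
        refine hge g _ hg fun j => ?_
        rw [sub_le_iff_le_add']
        obtain ⟨k, hik, hjk⟩ := exists_ge_ge i j
        obtain ⟨l, hl⟩ := hadd₁ k f g hf hg
        exact (hle l _ (add_nonneg hf hg)).trans
          (hl.trans (add_le_add (hanti f hf hik) (hanti g hg hjk)))
      · refine hge _ _ (add_nonneg hf hg) fun i => ?_
        obtain ⟨j, hj⟩ := hadd₂ i f g hf hg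
        exact (add_le_add (hle j f hf) (hle j g hg)).trans hj)
    (by
      intro c f hc hf
      apply le_antisymm (hscale c f hc hf)
      have h1 := hscale c⁻¹ (c • f) (inv_pos.2 hc) (smul_nonneg hc.le hf)
      rw [inv_smul_smul₀ hc.ne'] at h1
      have := smul_le_smul_of_nonneg_left h1 hc.le
      rwa [smul_inv_smul₀ hc.ne'] at this)
  obtain ⟨i₀, c, hc, hi₀⟩ := hbdd
  obtain ⟨e, he⟩ := hΘ.surj T <| isCentral_of_nonneg_of_le T hc
    (fun f hf => by rw [hT f hf]; exact hge f 0 hf fun i => hpos i f hf)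
    (fun f hf => by rw [hT f hf]; exact (hle i₀ f hf).trans (hi₀ f hf))
  refine ⟨e, fun f hf => ?_⟩
  rw [he, hT f hf]
  exact hT₀ f hf

/-- `C(K, ℝ)` is Dedekind complete and its action on positive elements is order continuous. -/
theorem exists_isGLB_of_directedOn (hΘ : IsCenterRep Θ) (hD : IsOrderDual E D pE)
    {S : Set C(K, ℝ)} (hne : S.Nonempty) (hdir : DirectedOn (· ≥ ·) S) (h0 : ∀ h ∈ S, 0 ≤ h) :
    ∃ e : C(K, ℝ), IsGLB S e ∧ ∀ f, 0 ≤ f → IsGLB ((fun h => Θ h f) '' S) (Θ e f) := by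
  have : Nonempty (↥S)ᵒᵈ := hne.to_subtype
  have : IsDirectedOrder (↥S)ᵒᵈ := ⟨fun a b => by
    obtain ⟨c, hc, hac, hbc⟩ := hdir a.ofDual a.ofDual.2 b.ofDual b.ofDual.2
    exact ⟨OrderDual.toDual ⟨c, hc⟩, hac, hbc⟩⟩
  obtain ⟨e, he⟩ := hΘ.exists_isGLB_range hD (ι := (↥S)ᵒᵈ)
    (fun i f => Θ i.ofDual.1 f)
    (fun f hf i j hij => hΘ.mono_left (show j.ofDual.1 ≤ i.ofDual.1 from hij) hf)
    (fun i f hf => hΘ.nonneg (h0 _ i.ofDual.2) hf)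
    (by
      obtain ⟨h, hh⟩ := hne
      refine ⟨OrderDual.toDual ⟨h, hh⟩, ‖h‖, norm_nonneg _, fun f hf => ?_⟩
      have := (le_abs_self _).trans (hΘ.abs_apply_le h f)
      rwa [abs_of_nonneg hf] at this)
    (fun i f g _ _ => ⟨i, ((hΘ.isLinearMap _).map_add f g).le⟩)
    (fun i f g _ _ => ⟨i, ((hΘ.isLinearMap _).map_add f g).ge⟩)
    (fun i c f _ _ => ⟨i, ((hΘ.isLinearMap _).map_smul c f).le⟩)
  have he' : ∀ f, 0 ≤ f → IsGLB ((fun h => Θ h f) '' S) (Θ e f) := by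
    intro f hf
    convert he f hf using 1
    ext d
    constructor
    · rintro ⟨h, hh, rfl⟩
      exact ⟨OrderDual.toDual ⟨h, hh⟩, rfl⟩
    · rintro ⟨i, rfl⟩
      exact ⟨_, i.ofDual.2, rfl⟩
  refine ⟨e, ⟨fun h hh => ?_, fun k hk => ?_⟩, he'⟩
  · exact (hΘ.le_iff _ _).2 fun f hf => (he' f hf).1 ⟨h, hh, rfl⟩
  · refine (hΘ.le_iff _ _).2 fun f hf => (he' f hf).2 ?_
    rintro _ ⟨h, hh, rfl⟩
    exact hΘ.mono_left (hk hh) hf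

theorem isGLB_image_apply (hΘ : IsCenterRep Θ) (hD : IsOrderDual E D pE)
    {S : Set C(K, ℝ)} (hne : S.Nonempty) (hdir : DirectedOn (· ≥ ·) S) (h0 : IsGLB S 0)
    {f : D} (hf : 0 ≤ f) : IsGLB ((fun h => Θ h f) '' S) 0 := by
  obtain ⟨e, he, H⟩ := hΘ.exists_isGLB_of_directedOn hD hne hdir fun h hh => h0.1 hh
  obtain rfl : e = 0 := he.unique h0
  simpa [hΘ.zero_apply] using H f hf

/-- The complementary band projection of the band generated by a positive element. -/
theorem exists_isGLB_sub_nsmul (hΘ : IsCenterRep Θ) (hD : IsOrderDual E D pE) {u : D}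
    (hu : 0 ≤ u) :
    ∃ q : C(K, ℝ), ∀ f, 0 ≤ f → IsGLB (Set.range fun n : ℕ => (f - n • u)⁺) (Θ q f) := by
  have hmono : ∀ f : D, Antitone fun n : ℕ => (f - n • u)⁺ := fun f m n hmn =>
    posPart_mono (sub_le_sub_left (nsmul_le_nsmul_left hu hmn) f)
  refine hΘ.exists_isGLB_range hD (fun (n : ℕ) f => (f - n • u)⁺) (fun f _ => hmono f)
    (fun _ _ _ => posPart_nonneg _) ⟨0, 1, zero_le_one, fun f hf => ?_⟩ ?_ ?_ ?_
  · simp [posPart_of_nonneg hf]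
  · intro n f g _ _
    refine ⟨2 * n, sup_le ?_ (add_nonneg (posPart_nonneg _) (posPart_nonneg _))⟩
    refine le_trans (le_of_eq ?_) (add_le_add (le_posPart (f - n • u)) (le_posPart (g - n • u)))
    rw [two_mul, add_nsmul]; abel
  · intro n f g hf hg
    refine ⟨n, ?_⟩
    have hn : 0 ≤ n • u := nsmul_nonneg hu n
    rw [posPart_def (f - n • u), posPart_def (g - n • u), sup_add, add_sup, add_sup]
    refine sup_le (sup_le ?_ ?_) (sup_le ?_ ?_)
    · refine le_trans ?_ (le_posPart _)
      rw [show f - n • u + (g - n • u) = f + g - n • u - n • u by abel]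
      exact sub_le_self _ hn
    · refine le_trans ?_ (le_posPart _)
      rw [add_zero]
      exact sub_le_sub_right (le_add_of_nonneg_right hg) _
    · refine le_trans ?_ (le_posPart _)
      rw [zero_add]
      exact sub_le_sub_right (le_add_of_nonneg_left hf) _
    · rw [zero_add]
      exact posPart_nonneg _
  · intro n c f hc _
    obtain ⟨m, hm⟩ := exists_nat_ge (c * n)
    refine ⟨m, ?_⟩
    rw [← posPart_smul_of_pos hc]
    apply posPart_mono
    rw [smul_sub]
    apply sub_le_sub_left
    rw [← Nat.cast_smul_eq_nsmul ℝ, ← Nat.cast_smul_eq_nsmul ℝ, smul_smul]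
    exact smul_le_smul_of_nonneg_right hm hu

end IsCenterRep

section OrderContinuous

variable {X : Type*} [Lattice X] [AddCommGroup X]

theorem IsOrderContinuousFun.sub {φ ψ : X → ℝ} (hφ : IsOrderContinuousFun φ)
    (hψ : IsOrderContinuousFun ψ) : IsOrderContinuousFun fun x => φ x - ψ x := by
  intro s hne hdir hs ε hε
  obtain ⟨x, hx, hx'⟩ := hφ s hne hdir hs (ε / 2) (half_pos hε)
  obtain ⟨y, hy, hy'⟩ := hψ s hne hdir hs (ε / 2) (half_pos hε)
  obtain ⟨z, hz, hxz, hyz⟩ := hdir x hx y hy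
  refine ⟨z, hz, fun w hw hwz => ?_⟩
  have h1 := hx' w hw (hwz.trans hxz)
  have h2 := hy' w hw (hwz.trans hyz)
  rw [abs_lt] at *
  constructor <;> linarith

theorem IsOrderContinuousFun.neg {φ : X → ℝ} (hφ : IsOrderContinuousFun φ) :
    IsOrderContinuousFun fun x => -φ x := by
  intro s hne hdir hs ε hε
  simpa only [abs_neg] using hφ s hne hdir hs ε hε

theorem IsOrderContinuousFun.congr {φ ψ : X → ℝ} (hφ : IsOrderContinuousFun φ)
    (h : ∀ x, ψ x = φ x) : IsOrderContinuousFun ψ :=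
  funext h ▸ hφ

end OrderContinuous

section ContinuousFunctions

variable {K : Type*} [TopologicalSpace K] [CompactSpace K]

theorem ContinuousMap.isGLB_mul_of_nonneg {S : Set C(K, ℝ)} (h0 : IsGLB S 0)
    {b : C(K, ℝ)} (hb : 0 ≤ b) : IsGLB ((fun h => b * h) '' S) 0 := by
  have hN : 0 < ‖b‖ + 1 := by positivity
  refine ⟨?_, fun k hk => ?_⟩
  · rintro _ ⟨h, hh, rfl⟩
    exact mul_nonneg hb (h0.1 hh)
  · have hk' : (‖b‖ + 1)⁻¹ • k ≤ 0 := by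
      apply h0.2
      intro h hh t
      have h1 : k t ≤ b t * h t := hk ⟨h, hh, rfl⟩ t
      have h2 : 0 ≤ h t := h0.1 hh t
      have h3 : b t ≤ ‖b‖ := (le_abs_self _).trans (b.norm_coe_le_norm t)
      change (‖b‖ + 1)⁻¹ * k t ≤ h t
      rw [inv_mul_le_iff₀ hN]
      nlinarith
    intro t
    have := hk' t
    change (‖b‖ + 1)⁻¹ * k t ≤ 0 at this
    change k t ≤ 0
    by_contra! hlt
    exact absurd this (not_le.2 (mul_pos (inv_pos.2 hN) hlt))

/-- An order continuous functional remains order continuous when multiplied by a function. -/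
theorem IsOrderContinuousFun.mul_left {ν : C(K, ℝ) →L[ℝ] ℝ} (hν : IsOrderContinuousFun ν)
    (b : C(K, ℝ)) : IsOrderContinuousFun fun h => ν (b * h) := by
  have key : ∀ b : C(K, ℝ), 0 ≤ b → IsOrderContinuousFun fun h => ν (b * h) := by
    intro b hb S hne hdir h0 ε hε
    obtain ⟨_, ⟨x, hx, rfl⟩, hx'⟩ := hν ((fun h => b * h) '' S) (hne.image _)
      (by
        rintro _ ⟨h, hh, rfl⟩ _ ⟨k, hk, rfl⟩
        obtain ⟨l, hl, hhl, hkl⟩ := hdir h hh k hk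
        exact ⟨_, ⟨l, hl, rfl⟩, mul_le_mul_of_nonneg_left hhl hb,
          mul_le_mul_of_nonneg_left hkl hb⟩)
      (ContinuousMap.isGLB_mul_of_nonneg h0 hb) ε hε
    exact ⟨x, hx, fun y hy hyx => hx' _ ⟨y, hy, rfl⟩ (mul_le_mul_of_nonneg_left hyx hb)⟩
  refine ((key b⁺ (posPart_nonneg _)).sub (key b⁻ (negPart_nonneg _))).congr fun h => ?_
  rw [← map_sub, ← sub_mul, posPart_sub_negPart]

/-- The functionals `ν(h·)` tend to zero in norm as `h` decreases to zero, when `ν` is order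
continuous. -/
theorem IsOrderContinuousFun.exists_norm_arensDot_lt {ν : C(K, ℝ) →L[ℝ] ℝ}
    (hν : IsOrderContinuousFun ν) {S : Set C(K, ℝ)} (hne : S.Nonempty)
    (hdir : DirectedOn (· ≥ ·) S) (h0 : IsGLB S 0) (h1 : ∀ h ∈ S, h ≤ 1) {ε : ℝ} (hε : 0 < ε) :
    ∃ h ∈ S, ‖arensDot C(K, ℝ) ν h‖ < ε := by
  obtain ⟨b, hb, hνb⟩ : ∃ b : C(K, ℝ), ‖b‖ ≤ 1 ∧ ‖ν‖ - ε / 4 < ν b := by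
    obtain ⟨b, hb, hb'⟩ := ν.exists_lt_apply_of_lt_opNorm (r := ‖ν‖ - ε / 4) (by linarith)
    rcases le_total 0 (ν b) with h | h
    · exact ⟨b, hb.le, by rwa [Real.norm_of_nonneg h] at hb'⟩
    · exact ⟨-b, by simpa using hb.le, by rw [map_neg]; rwa [Real.norm_of_nonpos h] at hb'⟩
  obtain ⟨h, hh, hbh⟩ := hν.mul_left b S hne hdir h0 (ε / 4) (by positivity)
  refine ⟨h, hh, lt_of_le_of_lt (b := ε / 2) ?_ (by linarith)⟩
  have hbh := hbh h hh le_rfl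
  have hbt : ∀ t, |b t| ≤ 1 := fun t => (b.norm_coe_le_norm t).trans hb
  have key : ∀ a : C(K, ℝ), ‖a‖ ≤ 1 → ν (h * a) ≤ ε / 2 := by
    intro a ha
    have hat : ∀ t, |a t| ≤ 1 := fun t => (a.norm_coe_le_norm t).trans ha
    have hc : ‖h * a + (1 - h) * b‖ ≤ 1 := by
      refine (ContinuousMap.norm_le _ zero_le_one).2 fun t => ?_
      have e1 : 0 ≤ h t := h0.1 hh t
      have e2 : h t ≤ 1 := h1 h hh t
      have e3 := abs_le.1 (hat t)
      have e4 := abs_le.1 (hbt t)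
      change |h t * a t + (1 - h t) * b t| ≤ 1
      rw [abs_le]
      constructor <;> nlinarith
    have := (le_abs_self _).trans ((ν.le_opNorm _).trans
      (mul_le_of_le_one_right (norm_nonneg ν) hc))
    rw [sub_mul, one_mul, map_add, map_sub, mul_comm h b] at this
    have := (abs_lt.1 hbh).2
    linarith
  refine ContinuousLinearMap.opNorm_le_of_unit_norm (by positivity) fun a ha => ?_
  change |ν (h * a)| ≤ ε / 2
  refine abs_le'.2 ⟨key a ha.le, ?_⟩
  have := key (-a) (by simpa using ha.le)
  simpa using this

end ContinuousFunctions

namespace IsCenterRep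

variable {E D DD K : Type*} [Lattice D] [AddCommGroup D] [IsOrderedAddMonoid D] [Module ℝ D]
  [Lattice DD] [AddCommGroup DD] [Module ℝ DD]
  [TopologicalSpace K] [CompactSpace K] {Θ : C(K, ℝ) → D → D} {pD : DD → D → ℝ}

/-- The functional `h ↦ x''(Θ h f)` on `C(K, ℝ)`. -/
theorem exists_orbitFunctional (hΘ : IsCenterRep Θ) (hDD : IsOrderDual D DD pD)
    [IsOrderedAddMonoid DD] (x : DD) (f : D) :
    ∃ μ : C(K, ℝ) →L[ℝ] ℝ, ∀ h, μ h = pD x (Θ h f) := by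
  refine ⟨LinearMap.mkContinuous ⟨⟨fun h => pD x (Θ h f), fun h k => ?_⟩, fun c h => ?_⟩
    (pD |x| |f|) fun h => ?_, fun h => rfl⟩
  · rw [hΘ.add_apply, hDD.map_add_right]
  · change pD x (Θ (c • h) f) = c * pD x (Θ h f)
    rw [hΘ.smul_apply, hDD.map_smul_right]
  · change |pD x (Θ h f)| ≤ _
    refine (hDD.abs_le _ _).trans
      ((hDD.mono_right (abs_nonneg x) (hΘ.abs_apply_le h f)).trans ?_)
    rw [hDD.map_smul_right, mul_comm]

variable [Lattice E] [AddCommGroup E] [IsOrderedAddMonoid E] [Module ℝ E] {pE : D → E → ℝ}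

/-- The functionals `h ↦ x''(Θ h f)` detect the nonzero positive elements of `C(K, ℝ)`. -/
theorem exists_apply_pos (hΘ : IsCenterRep Θ) (hD : IsOrderDual E D pE)
    (hDD : IsOrderDual D DD pD) {g : C(K, ℝ)} (hg : 0 ≤ g) (hg0 : g ≠ 0) :
    ∃ (x : DD) (f : D), 0 ≤ x ∧ 0 ≤ f ∧ 0 < pD x (Θ g f) := by
  obtain ⟨f, hf, hgf⟩ : ∃ f : D, 0 ≤ f ∧ Θ g f ≠ 0 := by
    by_contra! H
    exact hg0 (hΘ.eq_of_forall_nonneg fun f hf => by rw [H f hf, hΘ.zero_apply])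
  obtain ⟨x, hx, hx'⟩ : ∃ x : E, 0 ≤ x ∧ pE (Θ g f) x ≠ 0 := by
    by_contra! H
    refine hgf (hD.inj _ _ fun x => ?_)
    rw [← posPart_sub_negPart x, hD.map_sub_right, H _ (posPart_nonneg x),
      H _ (negPart_nonneg x), hD.map_zero_left, sub_zero]
  obtain ⟨y, hy, hy'⟩ := hDD.exists_of_nonneg (hD.lin_vec x).mk' fun f hf => hD.nonneg hf hx
  refine ⟨y, f, hy, hf, ?_⟩
  rw [hy']
  exact lt_of_le_of_ne (hD.nonneg (hΘ.nonneg hg hf) hx) (Ne.symm hx')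

variable [PosSMulMono ℝ D] [PosSMulMono ℝ E]

/-- A functional on `C(K, ℝ)` dominated by `h ↦ x''(Θ h f)` is of the same form. -/
theorem exists_eq_apply_of_le (hΘ : IsCenterRep Θ) (hDD : IsOrderDual D DD pD)
    (ν : C(K, ℝ) →ₗ[ℝ] ℝ) {x : DD} {f : D} (hx : 0 ≤ x) (hf : 0 ≤ f)
    (hν : ∀ h, ν h ≤ pD x (Θ |h| f)) : ∃ y : DD, ∀ h, ν h = pD y (Θ h f) := by
  let L : C(K, ℝ) →ₗ[ℝ] D :=
    ⟨⟨fun h => Θ h f, fun h k => hΘ.add_apply h k f⟩, fun c h => hΘ.smul_apply c h f⟩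
  have hLν : LinearMap.ker L ≤ LinearMap.ker ν := by
    intro h hh
    have h0 : Θ h f = 0 := hh
    have h1 := hν h
    have h2 := hν (-h)
    rw [abs_neg, map_neg] at h2
    rw [hΘ.abs_apply h hf, h0, abs_zero, hDD.map_zero_right] at h1 h2
    rw [LinearMap.mem_ker]
    linarith
  let g : D →ₗ.[ℝ] ℝ :=
    ⟨LinearMap.range L, (L.ker.liftQ ν hLν).comp L.quotKerEquivRange.symm.toLinearMap⟩
  have hg : ∀ h, g ⟨L h, LinearMap.mem_range_self L h⟩ = ν h := by
    intro h
    change (L.ker.liftQ ν hLν) (L.quotKerEquivRange.symm ⟨L h, _⟩) = ν h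
    rw [LinearMap.quotKerEquivRange_symm_apply_image]
    rfl
  obtain ⟨φ, hφ, hφN⟩ := exists_extension_of_le_sublinear g (fun d => pD x |d|)
    (fun c hc d => by
      have : |c • d| = c • |d| := by
        rw [← posPart_add_negPart, ← posPart_add_negPart, smul_add, posPart_smul_of_pos hc,
          ← posPart_neg, ← posPart_neg, ← smul_neg, posPart_smul_of_pos hc]
      rw [this, hDD.map_smul_right])
    (fun d e => by
      rw [← hDD.map_add_right]
      exact hDD.mono_right hx (abs_add_le d e))
    (by
      rintro ⟨_, h, rfl⟩
      rw [hg h]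
      refine (hν h).trans (le_of_eq ?_)
      rw [hΘ.abs_apply h hf]
      rfl)
  obtain ⟨y, hy⟩ := hDD.surj φ φ.isLinear fun a b => by
    have hab : ∀ d, a ≤ d → d ≤ b → |d| ≤ |a| + |b| := fun d had hdb =>
      abs_le'.2 ⟨hdb.trans ((le_abs_self b).trans (le_add_of_nonneg_left (abs_nonneg a))),
        (neg_le_neg had).trans ((neg_le_abs a).trans (le_add_of_nonneg_right (abs_nonneg b)))⟩
    refine ⟨-pD x (|a| + |b|), pD x (|a| + |b|), fun d had hdb => ?_⟩
    have h1 := (hφN d).trans (hDD.mono_right hx (hab d had hdb))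
    have h2 := (hφN (-d)).trans
      ((congrArg (pD x) (abs_neg d)).le.trans (hDD.mono_right hx (hab d had hdb)))
    rw [map_neg] at h2
    exact ⟨by linarith, h1⟩
  refine ⟨y, fun h => ?_⟩
  rw [hy, ← hg h]
  exact (hφ ⟨L h, LinearMap.mem_range_self L h⟩).symm

/-- An order continuous functional which is positive at `g ≥ 0` is a positive functional on some
nonzero order interval `[0, b]` with `b ≤ g`. -/
theorem exists_nonneg_on_interval (hΘ : IsCenterRep Θ) (hD : IsOrderDual E D pE)
    {σ : C(K, ℝ) →L[ℝ] ℝ} (hσ : IsOrderContinuousFun σ) {g : C(K, ℝ)} (hg : 0 ≤ g)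
    (hσg : 0 < σ g) :
    ∃ b, 0 ≤ b ∧ b ≤ g ∧ b ≠ 0 ∧ ∀ a, 0 ≤ a → a ≤ b → 0 ≤ σ a := by
  obtain ⟨m, -, hm⟩ := zorn_le_nonempty₀ (α := C(K, ℝ)ᵒᵈ)
    {b | 0 ≤ b.ofDual ∧ b.ofDual ≤ g ∧ σ g ≤ σ b.ofDual} (by
      intro c hc hchain y hy
      let S : Set C(K, ℝ) := {h | OrderDual.toDual h ∈ c}
      have hSne : S.Nonempty := ⟨y.ofDual, hy⟩
      have hSdir : DirectedOn (· ≥ ·) S := by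
        intro h hh k hk
        rcases hchain.total hh hk with H | H
        · exact ⟨k, hk, H, le_rfl⟩
        · exact ⟨h, hh, le_rfl, H⟩
      obtain ⟨e, he, -⟩ := hΘ.exists_isGLB_of_directedOn hD hSne hSdir fun h hh => (hc hh).1
      refine ⟨OrderDual.toDual e, ⟨he.2 fun h hh => (hc hh).1, (he.1 hy).trans (hc hy).2.1, ?_⟩,
        fun z hz => he.1 hz⟩
      change σ g ≤ σ e
      refine le_of_forall_pos_le_add fun ε hε => ?_
      obtain ⟨_, ⟨h, hh, rfl⟩, hx⟩ := hσ ((fun h => h - e) '' S) (hSne.image _)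
        (by
          rintro _ ⟨h, hh, rfl⟩ _ ⟨k, hk, rfl⟩
          obtain ⟨l, hl, hhl, hkl⟩ := hSdir h hh k hk
          exact ⟨_, ⟨l, hl, rfl⟩, sub_le_sub_right hhl e, sub_le_sub_right hkl e⟩)
        (by
          refine ⟨?_, fun k hk => ?_⟩
          · rintro _ ⟨h, hh, rfl⟩
            exact sub_nonneg.2 (he.1 hh)
          · have : k + e ≤ e := he.2 fun h hh => le_sub_iff_add_le.1 (hk ⟨h, hh, rfl⟩)
            simpa using this)
        ε hε
      have h1 := hx _ ⟨h, hh, rfl⟩ le_rfl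
      have h2 : σ g ≤ σ h := (hc hh).2.2
      rw [map_sub, abs_lt] at h1
      linarith)
    (OrderDual.toDual g) ⟨hg, le_rfl, le_rfl⟩
  refine ⟨m.ofDual, hm.1.1, hm.1.2.1, ?_, fun a ha ham => ?_⟩
  · intro h0
    have := hm.1.2.2
    rw [h0, map_zero] at this
    linarith
  · by_contra! hlt
    have h1 : OrderDual.toDual (m.ofDual - a) ≤ m := hm.2
      ⟨sub_nonneg.2 ham, (sub_le_self _ ha).trans hm.1.2.1, by
        have := hm.1.2.2
        change σ g ≤ σ (m.ofDual - a)
        rw [map_sub]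
        linarith⟩ (show m.ofDual - a ≤ m.ofDual from sub_le_self _ ha)
    have h2 : m.ofDual ≤ m.ofDual - a := h1
    have h3 : a = 0 := le_antisymm (by simpa using h2) ha
    rw [h3, map_zero] at hlt
    exact lt_irrefl _ hlt

variable [IsOrderedAddMonoid DD]

/-- Below every nonzero `g ≥ 0`, an order continuous functional is dominated by some
`h ↦ x''(Θ h f)` on a nonzero order interval, if the latter are all order continuous. -/
theorem exists_dominated_on_interval (hΘ : IsCenterRep Θ) (hD : IsOrderDual E D pE)
    (hDD : IsOrderDual D DD pD)
    (hcont : ∀ (x : DD) (f : D), IsOrderContinuousFun fun h => pD x (Θ h f))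
    {ν : C(K, ℝ) →L[ℝ] ℝ} (hν : IsOrderContinuousFun ν) {g : C(K, ℝ)} (hg : 0 ≤ g)
    (hg0 : g ≠ 0) :
    ∃ (b : C(K, ℝ)) (x : DD) (f : D), 0 ≤ b ∧ b ≤ g ∧ b ≠ 0 ∧ 0 ≤ x ∧ 0 ≤ f ∧
      ∀ a, 0 ≤ a → a ≤ b → ν a ≤ pD x (Θ a f) := by
  obtain ⟨x, f, hx, hf, hpos⟩ := hΘ.exists_apply_pos hD hDD hg hg0
  obtain ⟨n, hn⟩ := exists_nat_gt (ν g / pD x (Θ g f))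
  rw [div_lt_iff₀ hpos] at hn
  obtain ⟨μ, hμ⟩ := hΘ.exists_orbitFunctional hDD x ((n : ℝ) • f)
  have hμ' : ∀ h, μ h = n * pD x (Θ h f) := fun h => by
    rw [hμ, (hΘ.isLinearMap h).map_smul, hDD.map_smul_right]
  obtain ⟨b, hb, hbg, hb0, H⟩ := hΘ.exists_nonneg_on_interval hD (σ := μ - ν)
    (((hcont x ((n : ℝ) • f)).sub hν).congr fun h => by simp [hμ]) hg
    (by
      rw [_root_.sub_apply, hμ', sub_pos]
      exact hn)
  refine ⟨b, x, (n : ℝ) • f, hb, hbg, hb0, hx, smul_nonneg n.cast_nonneg hf, fun a ha hab => ?_⟩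
  have := H a ha hab
  rw [_root_.sub_apply, hμ] at this
  linarith

end IsCenterRep

theorem ContinuousLinearMap.exists_bound_bidual {V : Type*} [SeminormedAddCommGroup V]
    [NormedSpace ℝ V] (F : (V →L[ℝ] ℝ) →L[ℝ] ℝ) :
    ∃ C : ℝ, 0 < C ∧ ∀ μ, ‖F μ‖ ≤ C * ‖μ‖ :=
  F.bound

section ContinuousFunctions

variable {K : Type*} [TopologicalSpace K]

theorem ContinuousMap.abs_mul_le_of_norm_le {a b : C(K, ℝ)} (hb : 0 ≤ b) (hb1 : b ≤ 1) :
    |b * a| ≤ |a| := by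
  intro t
  have h0 : 0 ≤ b t := hb t
  have h1 : b t ≤ 1 := hb1 t
  change |b t * a t| ≤ |a t|
  rw [abs_mul, abs_of_nonneg h0]
  exact mul_le_of_le_one_left (abs_nonneg _) h1

variable [CompactSpace K]

/-- A functional dominated by a positive one on `[0, b]` is dominated on all multiples of `b`. -/
theorem ContinuousLinearMap.apply_mul_le_of_le {ν μ : C(K, ℝ) →L[ℝ] ℝ}
    (hμ : dualNonneg μ) {b : C(K, ℝ)} (hb : 0 ≤ b) (hb1 : b ≤ 1)
    (h₁ : ∀ a, 0 ≤ a → a ≤ b → ν a ≤ μ a) (h₂ : ∀ a, 0 ≤ a → a ≤ b → -ν a ≤ μ a)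
    (a : C(K, ℝ)) : ν (b * a) ≤ μ |a| := by
  have key : ∀ a : C(K, ℝ), 0 ≤ a → ν (b * a) ≤ μ a ∧ -ν (b * a) ≤ μ a := by
    intro a ha
    have hN : 0 < ‖a‖ + 1 := by positivity
    set c := (‖a‖ + 1)⁻¹ • (b * a) with hc
    have hca : b * a = (‖a‖ + 1) • c := by rw [hc, smul_inv_smul₀ hN.ne']
    have hc0 : 0 ≤ c := smul_nonneg (inv_nonneg.2 hN.le) (mul_nonneg hb ha)
    have hcb : c ≤ b := by
      intro t
      have e1 : 0 ≤ b t := hb t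
      have e2 : a t ≤ ‖a‖ := (le_abs_self _).trans (a.norm_coe_le_norm t)
      change (‖a‖ + 1)⁻¹ * (b t * a t) ≤ b t
      rw [inv_mul_le_iff₀ hN]
      nlinarith
    have hba : μ (b * a) ≤ μ a := by
      have := hμ (a - b * a) (sub_nonneg.2 <| by
        have := ContinuousMap.abs_mul_le_of_norm_le (a := a) hb hb1
        rwa [abs_of_nonneg ha, abs_of_nonneg (mul_nonneg hb ha)] at this)
      rw [map_sub] at this
      linarith
    have e1 := mul_le_mul_of_nonneg_left (h₁ c hc0 hcb) hN.le
    have e2 := mul_le_mul_of_nonneg_left (h₂ c hc0 hcb) hN.le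
    have e3 : ν (b * a) = (‖a‖ + 1) * ν c := by rw [hca, map_smul, smul_eq_mul]
    have e4 : μ (b * a) = (‖a‖ + 1) * μ c := by rw [hca, map_smul, smul_eq_mul]
    constructor <;> linarith
  have e1 := (key _ (posPart_nonneg a)).1
  have e2 := (key _ (negPart_nonneg a)).2
  have e3 : ν (b * a) = ν (b * a⁺) - ν (b * a⁻) := by
    rw [← map_sub, ← mul_sub, posPart_sub_negPart]
  rw [← posPart_add_negPart, map_add, e3]
  linarith

theorem abs_apply_le_dualAbs (μ : C(K, ℝ) →L[ℝ] ℝ) {b : C(K, ℝ)} (hb : 0 ≤ b) :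
    |μ b| ≤ dualAbs μ b := by
  have hbdd : BddAbove ((fun a => μ a) '' {a : C(K, ℝ) | |a| ≤ b}) := by
    refine ⟨‖μ‖ * ‖b‖, ?_⟩
    rintro _ ⟨a, ha, rfl⟩
    refine (le_abs_self _).trans ((μ.le_opNorm a).trans
      (mul_le_mul_of_nonneg_left ?_ (norm_nonneg _)))
    refine (ContinuousMap.norm_le _ (norm_nonneg _)).2 fun t => ?_
    exact (ha t : |a t| ≤ b t).trans ((le_abs_self _).trans (b.norm_coe_le_norm t))
  refine abs_le'.2 ⟨le_csSup hbdd ⟨b, (abs_of_nonneg hb).le, rfl⟩, ?_⟩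
  refine le_csSup hbdd ⟨-b, ?_, map_neg μ b⟩
  rw [Set.mem_ofPred_eq, abs_neg, abs_of_nonneg hb]

theorem eq_zero_of_dualDisjoint_self {μ : C(K, ℝ) →L[ℝ] ℝ} (h : DualDisjoint μ μ) : μ = 0 := by
  have key : ∀ a : C(K, ℝ), 0 ≤ a → μ a = 0 := by
    intro a ha
    refine abs_eq_zero.1 (le_antisymm (le_of_forall_pos_le_add fun ε hε => ?_) (abs_nonneg _))
    obtain ⟨b, c, hb, hc, rfl, hbc⟩ := h a ha ε hε
    rw [map_add, zero_add]
    exact (_root_.abs_add_le _ _).trans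
      ((add_le_add (abs_apply_le_dualAbs μ hb) (abs_apply_le_dualAbs μ hc)).trans hbc.le)
  ext a
  rw [← posPart_sub_negPart a, map_sub, key _ (posPart_nonneg a), key _ (negPart_nonneg a)]
  simp

end ContinuousFunctions

namespace IsCenterRep

variable {E D DD K : Type*} [Lattice D] [AddCommGroup D] [IsOrderedAddMonoid D] [Module ℝ D]
  [PosSMulMono ℝ D] [Lattice DD] [AddCommGroup DD] [Module ℝ DD]
  [TopologicalSpace K] [CompactSpace K] {Θ : C(K, ℝ) → D → D} {pD : DD → D → ℝ}

theorem isOrderContinuousFun_orbit [Lattice E] [AddCommGroup E] [IsOrderedAddMonoid E]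
    [Module ℝ E] [PosSMulMono ℝ E] {pE : D → E → ℝ}
    (hΘ : IsCenterRep Θ) (hD : IsOrderDual E D pE) (hDD : IsOrderDual D DD pD) {x : DD}
    (hx : IsOrderContinuousFun (pD x)) (f : D) :
    IsOrderContinuousFun fun h => pD x (Θ h f) := by
  have key : ∀ f : D, 0 ≤ f → IsOrderContinuousFun fun h => pD x (Θ h f) := by
    intro f hf S hne hdir h0 ε hε
    obtain ⟨_, ⟨h, hh, rfl⟩, H⟩ := hx ((fun h => Θ h f) '' S) (hne.image _)
      (by
        rintro _ ⟨h, hh, rfl⟩ _ ⟨k, hk, rfl⟩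
        obtain ⟨l, hl, hhl, hkl⟩ := hdir h hh k hk
        exact ⟨_, ⟨l, hl, rfl⟩, hΘ.mono_left hhl hf, hΘ.mono_left hkl hf⟩)
      (hΘ.isGLB_image_apply hD hne hdir h0 hf) ε hε
    exact ⟨h, hh, fun k hk hkh => H _ ⟨k, hk, rfl⟩ (hΘ.mono_left hkh hf)⟩
  refine ((key f⁺ (posPart_nonneg _)).sub (key f⁻ (negPart_nonneg _))).congr fun h => ?_
  rw [← hDD.map_sub_right, ← (hΘ.isLinearMap h).map_sub, posPart_sub_negPart]

variable [IsOrderedAddMonoid DD] [Lattice E] [AddCommGroup E] [IsOrderedAddMonoid E] [Module ℝ E]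
  [PosSMulMono ℝ E] {pE : D → E → ℝ}

/-- Order continuous functionals are dominated by functionals `h ↦ x''(Θ h f)` on large parts of
`K`. -/
theorem exists_dominated_mul (hΘ : IsCenterRep Θ) (hD : IsOrderDual E D pE)
    (hDD : IsOrderDual D DD pD)
    (hcont : ∀ (x : DD) (f : D), IsOrderContinuousFun fun h => pD x (Θ h f))
    {ν : C(K, ℝ) →L[ℝ] ℝ} (hν : IsOrderContinuousFun ν) {g : C(K, ℝ)} (hg : 0 ≤ g)
    (hg1 : g ≤ 1) (hg0 : g ≠ 0) :
    ∃ (b : C(K, ℝ)) (x : DD) (f : D), 0 ≤ b ∧ b ≤ g ∧ b ≠ 0 ∧ 0 ≤ x ∧ 0 ≤ f ∧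
      ∀ a, ν (b * a) ≤ pD x (Θ |a| f) := by
  obtain ⟨b₁, x₁, f₁, hb₁, hbg₁, hb0₁, hx₁, hf₁, H₁⟩ :=
    hΘ.exists_dominated_on_interval hD hDD hcont hν hg hg0
  obtain ⟨b, x₂, f₂, hb, hb₂, hb0, hx₂, hf₂, H₂⟩ :=
    hΘ.exists_dominated_on_interval hD hDD hcont (ν := -ν) hν.neg hb₁ hb0₁
  obtain ⟨μ, hμ⟩ := hΘ.exists_orbitFunctional hDD (x₁ + x₂) (f₁ + f₂)
  have hexp : ∀ a, μ a = pD x₁ (Θ a f₁) + pD x₁ (Θ a f₂) +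
      (pD x₂ (Θ a f₁) + pD x₂ (Θ a f₂)) := fun a => by
    rw [hμ, (hΘ.isLinearMap a).map_add, hDD.map_add_left, hDD.map_add_right, hDD.map_add_right]
  have hpos : ∀ {x f} a, 0 ≤ x → 0 ≤ f → 0 ≤ a → 0 ≤ pD x (Θ a f) := fun a hx hf ha =>
    hDD.nonneg hx (hΘ.nonneg ha hf)
  refine ⟨b, x₁ + x₂, f₁ + f₂, hb, hb₂.trans hbg₁, hb0, add_nonneg hx₁ hx₂, add_nonneg hf₁ hf₂,
    fun a => ?_⟩
  rw [← hμ]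
  refine ContinuousLinearMap.apply_mul_le_of_le ?_ hb (hb₂.trans (hbg₁.trans hg1)) ?_ ?_ a
  · intro a ha
    rw [hμ]
    exact hpos a (add_nonneg hx₁ hx₂) (add_nonneg hf₁ hf₂) ha
  all_goals
    intro a ha hab
    have e1 := hpos a hx₁ hf₂ ha
    have e2 := hpos a hx₂ hf₁ ha
    have e3 := hpos a hx₁ hf₁ ha
    have e4 := hpos a hx₂ hf₂ ha
    rw [hexp]
  · linarith [H₁ a ha (hab.trans hb₂)]
  · have : -ν a ≤ _ := H₂ a ha hab
    linarith

/-- If the functionals `h ↦ x''(Θ h f)` are order continuous, then an element of the bidual which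
annihilates them annihilates all order continuous functionals. -/
theorem apply_eq_zero_of_isOrderContinuousFun (hΘ : IsCenterRep Θ) (hD : IsOrderDual E D pE)
    (hDD : IsOrderDual D DD pD)
    (hcont : ∀ (x : DD) (f : D), IsOrderContinuousFun fun h => pD x (Θ h f))
    {F : (C(K, ℝ) →L[ℝ] ℝ) →L[ℝ] ℝ}
    (hF : ∀ (x : DD) (f : D) (μ : C(K, ℝ) →L[ℝ] ℝ), (∀ h, μ h = pD x (Θ h f)) → F μ = 0)
    {ν : C(K, ℝ) →L[ℝ] ℝ} (hν : IsOrderContinuousFun ν) : F ν = 0 := by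
  let S : Set C(K, ℝ) := {h | 0 ≤ h ∧ h ≤ 1 ∧ ∃ (x : DD) (f : D), 0 ≤ x ∧ 0 ≤ f ∧
    ∀ a, ν (h * a) ≤ pD x (Θ |a| f)}
  have hS0 : (0 : C(K, ℝ)) ∈ S := ⟨le_rfl, zero_le_one, 0, 0, le_rfl, le_rfl, fun a => by
    simp [hDD.map_zero_left]⟩
  have hSF : ∀ h ∈ S, F (arensDot C(K, ℝ) ν h) = 0 := by
    rintro h ⟨-, -, x, f, hx, hf, H⟩
    obtain ⟨y, hy⟩ := hΘ.exists_eq_apply_of_le hDD (arensDot C(K, ℝ) ν h).toLinearMap hx hf H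
    exact hF y f _ hy
  have hSunion : ∀ h ∈ S, ∀ k ∈ S, 1 - (1 - h) * (1 - k) ∈ S := by
    rintro h ⟨hh0, hh1, x₁, f₁, hx₁, hf₁, H₁⟩ k ⟨hk0, hk1, x₂, f₂, hx₂, hf₂, H₂⟩
    have h1 : 0 ≤ 1 - h := sub_nonneg.2 hh1
    have h2 : 0 ≤ 1 - k := sub_nonneg.2 hk1
    refine ⟨sub_nonneg.2 (mul_le_one₀ (sub_le_self _ hh0) h2 (sub_le_self _ hk0)),
      sub_le_self _ (mul_nonneg h1 h2), x₁ + x₂, f₁ + f₂, add_nonneg hx₁ hx₂,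
      add_nonneg hf₁ hf₂, fun a => ?_⟩
    have e : (1 - (1 - h) * (1 - k)) * a = h * a + k * ((1 - h) * a) := by ring
    have e1 := H₁ a
    have e2 : ν (k * ((1 - h) * a)) ≤ pD x₂ (Θ |a| f₂) := (H₂ ((1 - h) * a)).trans
      (hDD.mono_right hx₂ (hΘ.mono_left
        (ContinuousMap.abs_mul_le_of_norm_le h1 (sub_le_self _ hh0)) hf₂))
    have e3 := hDD.nonneg hx₁ (hΘ.nonneg (abs_nonneg a) hf₂)
    have e4 := hDD.nonneg hx₂ (hΘ.nonneg (abs_nonneg a) hf₁)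
    rw [e, map_add, (hΘ.isLinearMap _).map_add, hDD.map_add_left, hDD.map_add_right,
      hDD.map_add_right]
    linarith
  have hSpow : ∀ b ∈ S, ∀ n : ℕ, 1 - (1 - b) ^ n ∈ S := by
    intro b hb n
    induction n with
    | zero => simpa using hS0
    | succ n ih => simpa [pow_succ] using hSunion _ ih b hb
  have hglb : IsGLB ((fun h => 1 - h) '' S) 0 := by
    refine ⟨?_, fun g hg => ?_⟩
    · rintro _ ⟨h, hh, rfl⟩
      exact sub_nonneg.2 hh.2.1
    · have hg' : ∀ h ∈ S, g⁺ ≤ 1 - h := fun h hh =>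
        sup_le (hg ⟨h, hh, rfl⟩) (sub_nonneg.2 hh.2.1)
      rw [← posPart_eq_zero]
      by_contra hne
      have hg1 : g⁺ ≤ 1 := by simpa using hg' 0 hS0
      obtain ⟨b, x, f, hb, hbg, hb0, hx, hf, H⟩ :=
        hΘ.exists_dominated_mul hD hDD hcont hν (posPart_nonneg g) hg1 hne
      have hbS : b ∈ S := ⟨hb, hbg.trans hg1, x, f, hx, hf, H⟩
      obtain ⟨t, ht⟩ : ∃ t, b t ≠ 0 := by
        by_contra! h0
        exact hb0 (ContinuousMap.ext h0)
      have hbt : 0 < b t := lt_of_le_of_ne (hb t) (Ne.symm ht)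
      have hbt' : b t ≤ g⁺ t := hbg t
      have hbt1 : b t ≤ 1 := (hbg.trans hg1) t
      obtain ⟨n, hn⟩ := exists_pow_lt_of_lt_one hbt (show 1 - b t < 1 by linarith)
      have : g⁺ t ≤ 1 - (1 - (1 - b t) ^ n) := hg' _ (hSpow b hbS n) t
      linarith
  have hdir : DirectedOn (· ≥ ·) ((fun h => 1 - h) '' S) := by
    rintro _ ⟨h, hh, rfl⟩ _ ⟨k, hk, rfl⟩
    refine ⟨_, ⟨_, hSunion h hh k hk, rfl⟩, ?_, ?_⟩
    · change 1 - (1 - (1 - h) * (1 - k)) ≤ 1 - h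
      rw [sub_sub_cancel]
      exact mul_le_of_le_one_right (sub_nonneg.2 hh.2.1) (sub_le_self _ hk.1)
    · change 1 - (1 - (1 - h) * (1 - k)) ≤ 1 - k
      rw [sub_sub_cancel]
      exact mul_le_of_le_one_left (sub_nonneg.2 hk.2.1) (sub_le_self _ hh.1)
  refine abs_eq_zero.1 (le_antisymm (le_of_forall_pos_le_add fun ε hε => ?_) (abs_nonneg _))
  obtain ⟨C, hC, hFC⟩ := ContinuousLinearMap.exists_bound_bidual (V := C(K, ℝ)) F
  obtain ⟨_, ⟨h, hh, rfl⟩, hlt⟩ := hν.exists_norm_arensDot_lt (Set.Nonempty.image _ ⟨0, hS0⟩)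
    hdir hglb (by rintro _ ⟨h, hh, rfl⟩; exact sub_le_self _ hh.1) (div_pos hε hC)
  have e : ν = arensDot C(K, ℝ) ν h + arensDot C(K, ℝ) ν (1 - h) := by
    ext a
    change ν a = ν (h * a) + ν ((1 - h) * a)
    rw [← map_add]
    congr 1
    ring
  rw [e, map_add, hSF h hh, zero_add, zero_add]
  refine (hFC _).trans ?_
  rw [lt_div_iff₀' hC] at hlt
  exact hlt.le

/-- A functional `x''` is order continuous if all the functionals `h ↦ x''(Θ h f)` are. -/
theorem isOrderContinuousFun_of_orbit (hΘ : IsCenterRep Θ) (hD : IsOrderDual E D pE)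
    (hDD : IsOrderDual D DD pD)
    (hcont : ∀ (x : DD) (f : D), IsOrderContinuousFun fun h => pD x (Θ h f)) (x : DD) :
    IsOrderContinuousFun (pD x) := by
  have key : ∀ x : DD, 0 ≤ x → IsOrderContinuousFun (pD x) := by
    intro x hx s hne hdir hs ε hε
    obtain ⟨f, hfs⟩ := hne
    have hf : 0 ≤ f := hs.1 hfs
    obtain ⟨δ, hδ, hδf⟩ : ∃ δ : ℝ, 0 < δ ∧ δ * pD x f < ε / 2 := by
      have hN : 0 < pD x f + 1 := by linarith [hDD.nonneg hx hf]
      refine ⟨ε / 2 / (pD x f + 1), by positivity, ?_⟩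
      rw [div_mul_eq_mul_div, div_lt_iff₀ hN]
      nlinarith
    have hδf0 : 0 ≤ δ • f := smul_nonneg hδ.le hf
    choose q hq using fun y : D => hΘ.exists_isGLB_sub_nsmul hD (posPart_nonneg (y - δ • f))
    have hq0 : ∀ y, 0 ≤ q y := fun y => (hΘ.le_iff _ _).2 fun g hg => by
      rw [hΘ.zero_apply]
      refine (hq y g hg).2 ?_
      rintro _ ⟨n, rfl⟩
      exact posPart_nonneg _
    have hqle : ∀ y g, 0 ≤ g → ∀ n : ℕ, Θ (q y) g ≤ (g - n • (y - δ • f)⁺)⁺ :=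
      fun y g hg n => (hq y g hg).1 ⟨n, rfl⟩
    have hq1 : ∀ y, q y ≤ 1 := fun y => (hΘ.le_iff _ _).2 fun g hg => by
      rw [hΘ.one]
      simpa [posPart_of_nonneg hg] using hqle y g hg 0
    have hmono : ∀ y z, y ≤ z → q z ≤ q y := fun y z hyz => (hΘ.le_iff _ _).2 fun g hg => by
      refine (hq y g hg).2 ?_
      rintro _ ⟨n, rfl⟩
      refine (hqle z g hg n).trans (posPart_mono (sub_le_sub_left (nsmul_le_nsmul_right ?_ n) g))
      exact posPart_mono (sub_le_sub_right hyz _)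
    have hqu : ∀ y, Θ (q y) (y - δ • f)⁺ ≤ 0 := fun y => by
      simpa using hqle y (y - δ • f)⁺ (posPart_nonneg _) 1
    have hupper : ∀ y, 0 ≤ y → Θ (q y) y ≤ δ • f := by
      intro y hy
      have h1 : y ≤ δ • f + (y - δ • f)⁺ := by
        rw [← sub_le_iff_le_add']
        exact le_posPart _
      refine (hΘ.mono_right (hq0 y) h1).trans ?_
      rw [(hΘ.isLinearMap _).map_add]
      refine (add_le_of_nonpos_right (hqu y)).trans ?_
      simpa [hΘ.one] using hΘ.mono_left (hq1 y) hδf0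
    have hlower : ∀ y, 0 ≤ y → δ • Θ (1 - q y) f ≤ y := by
      intro y hy
      set w := y - δ • f with hw
      have hwneg : w⁻ ≤ Θ (q y) (δ • f) := by
        refine (hq y _ hδf0).2 ?_
        rintro _ ⟨n, rfl⟩
        have hdisj : w⁻ ⊓ (n • w⁺) = 0 := by
          rw [inf_comm, ← Nat.cast_smul_eq_nsmul ℝ]
          exact smul_inf_eq_zero_of_inf_eq_zero n.cast_nonneg (posPart_inf_negPart_eq_zero w)
        have h1 : w⁻ ≤ δ • f := by
          rw [negPart_def]
          refine sup_le ?_ hδf0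
          rw [hw, neg_sub]
          exact sub_le_self _ hy
        have h2 : w⁻ = (w⁻ - n • w⁺)⁺ := by
          have := sub_inf w⁻ (n • w⁺) w⁻
          rwa [hdisj, sub_zero, sub_self, sup_comm] at this
        rw [h2]
        exact posPart_mono (sub_le_sub_right h1 _)
      rw [hΘ.sub_apply, hΘ.one, smul_sub, ← (hΘ.isLinearMap _).map_smul]
      have h3 : -w ≤ Θ (q y) (δ • f) := (neg_le_negPart w).trans hwneg
      rw [hw, neg_sub] at h3
      exact sub_le_comm.1 h3
    obtain ⟨_, ⟨y, ⟨hys, hyf⟩, rfl⟩, H⟩ := hcont x f ((fun y => 1 - q y) '' {y | y ∈ s ∧ y ≤ f})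
      ⟨_, f, ⟨hfs, le_rfl⟩, rfl⟩
      (by
        rintro _ ⟨y, ⟨hy, hyf⟩, rfl⟩ _ ⟨z, ⟨hz, hzf⟩, rfl⟩
        obtain ⟨v, hv, hyv, hzv⟩ := hdir y hy z hz
        exact ⟨_, ⟨v, ⟨hv, hyv.trans hyf⟩, rfl⟩, sub_le_sub_left (hmono _ _ hyv) 1,
          sub_le_sub_left (hmono _ _ hzv) 1⟩)
      (by
        refine ⟨?_, fun k hk => ?_⟩
        · rintro _ ⟨y, -, rfl⟩
          exact sub_nonneg.2 (hq1 y)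
        have hk' : ∀ y ∈ s, y ≤ f → k⁺ ≤ 1 - q y := fun y hy hyf =>
          sup_le (hk ⟨y, ⟨hy, hyf⟩, rfl⟩) (sub_nonneg.2 (hq1 y))
        have hkf : Θ k⁺ f ≤ 0 := by
          have : δ • Θ k⁺ f ≤ 0 := hs.2 fun z hz => by
            obtain ⟨v, hv, hfv, hzv⟩ := hdir f hfs z hz
            exact ((smul_le_smul_of_nonneg_left (hΘ.mono_left (hk' v hv hfv) hf) hδ.le).trans
              (hlower v (hs.1 hv))).trans hzv
          have := smul_le_smul_of_nonneg_left this (inv_nonneg.2 hδ.le)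
          rwa [inv_smul_smul₀ hδ.ne', smul_zero] at this
        have huf : (f - δ • f)⁺ ≤ f := sup_le (sub_le_self _ hδf0) hf
        have hclaim : ∀ a : C(K, ℝ), 0 ≤ a → a ≤ 1 → Θ a f ≤ 0 → a ≤ q f := by
          intro a ha0 ha1 haf
          refine (hΘ.le_iff _ _).2 fun g hg => (hq f g hg).2 ?_
          rintro _ ⟨n, rfl⟩
          have h1 : g ≤ (g - n • (f - δ • f)⁺)⁺ + n • (f - δ • f)⁺ := by
            rw [← sub_le_iff_le_add]
            exact le_posPart _
          have h2 : Θ a (f - δ • f)⁺ ≤ 0 := (hΘ.mono_right ha0 huf).trans haf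
          have h3 : Θ a (n • (f - δ • f)⁺) ≤ 0 := by
            rw [← Nat.cast_smul_eq_nsmul ℝ n, (hΘ.isLinearMap _).map_smul]
            exact smul_nonpos_of_nonneg_of_nonpos n.cast_nonneg h2
          refine (hΘ.mono_right ha0 h1).trans ?_
          rw [(hΘ.isLinearMap _).map_add]
          refine (add_le_of_nonpos_right h3).trans ?_
          simpa only [hΘ.one] using hΘ.mono_left ha1 (posPart_nonneg (g - n • (f - δ • f)⁺))
        rw [← posPart_nonpos]
        intro t
        change k⁺ t ≤ 0
        by_contra! ht
        have h1 : k⁺ t ≤ 1 - q f t := hk' f hfs le_rfl t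
        have hc : 0 ≤ (k⁺ t)⁻¹ := inv_nonneg.2 ht.le
        have h2 := hclaim (1 ⊓ (k⁺ t)⁻¹ • k⁺)
          (le_inf zero_le_one (smul_nonneg hc (posPart_nonneg k))) inf_le_left (by
            refine (hΘ.mono_left inf_le_right hf).trans ?_
            rw [hΘ.smul_apply]
            simpa using smul_le_smul_of_nonneg_left hkf hc) t
        have h3 : min 1 ((k⁺ t)⁻¹ * k⁺ t) ≤ q f t := h2
        rw [inv_mul_cancel₀ ht.ne', min_self] at h3
        linarith)
      (ε / 2) (half_pos hε)
    refine ⟨y, hys, fun z hz hzy => ?_⟩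
    have hz0 : 0 ≤ z := hs.1 hz
    have hzf := hzy.trans hyf
    have h1 := (abs_lt.1 (H _ ⟨z, ⟨hz, hzf⟩, rfl⟩ (sub_le_sub_left (hmono _ _ hzy) 1))).2
    have h2 : pD x z = pD x (Θ (q z) z) + pD x (Θ (1 - q z) z) := by
      rw [← hDD.map_add_right, ← hΘ.add_apply, add_sub_cancel, hΘ.one]
    have h3 := hDD.mono_right hx (hupper z hz0)
    have h4 := hDD.mono_right hx (hΘ.mono_right (sub_nonneg.2 (hq1 z)) hzf)
    rw [hDD.map_smul_right] at h3
    rw [abs_of_nonneg (hDD.nonneg hx hz0)]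
    linarith
  refine ((key x⁺ (posPart_nonneg _)).sub (key x⁻ (negPart_nonneg _))).congr fun f => ?_
  rw [← hDD.map_sub_left, posPart_sub_negPart]

end IsCenterRep

/-- Corollary 6(4).  Same setting as Corollary 6(2)–(3): `E` a Riesz
space with point separating order dual, `Z(E^∼) = C(K)` with `K` hyperstonian,
`π ∈ C(K)''` the idempotent with `Z(E^{∼∼}) = π⬝C(K)''` and `Ker(m) = (1-π)⬝C(K)''`,
and `p ∈ C(K)''` the band projection onto `C(K)ₙ' = C(K)_*`.  Then
`E^{∼∼} = (E^∼)ₙ^∼` (every order bounded functional on `E^∼` is order continuous) if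
and only if `p = π`. -/
theorem statement18
    {E D DD K : Type*}
    [Lattice E] [AddCommGroup E] [Module ℝ E]
    [CovariantClass E E (· + ·) (· ≤ ·)] [PosSMulMono ℝ E]
    [Lattice D] [AddCommGroup D] [Module ℝ D]
    [CovariantClass D D (· + ·) (· ≤ ·)] [PosSMulMono ℝ D]
    [Lattice DD] [AddCommGroup DD] [Module ℝ DD]
    [CovariantClass DD DD (· + ·) (· ≤ ·)] [PosSMulMono ℝ DD]
    [TopologicalSpace K] [CompactSpace K] [T2Space K]
    (pE : D → E → ℝ) (hD : IsOrderDual E D pE) (hsep : SepPoints pE)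
    (pD : DD → D → ℝ) (hDD : IsOrderDual D DD pD)
    -- `K` is hyperstonian:
    (hStonian : ExtremallyDisconnected K)
    (hKsep : ∀ h : C(K, ℝ), h ≠ 0 → ∃ φ : C(K, ℝ) → ℝ,
      IsLinearMap ℝ φ ∧ IsOrdBdd φ ∧ IsOrderContinuousFun φ ∧ φ h ≠ 0)
    -- `Θ` realizes `Z(E^∼) = C(K)`:
    (Θ : C(K, ℝ) → D → D)
    (hΘadd : ∀ h h' : C(K, ℝ), Θ (h + h') = Θ h + Θ h')
    (hΘsmul : ∀ (c : ℝ) (h : C(K, ℝ)), Θ (c • h) = c • Θ h)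
    (hΘmul : ∀ (h h' : C(K, ℝ)) (f : D), Θ (h * h') f = Θ h (Θ h' f))
    (hΘone : ∀ f : D, Θ 1 f = f)
    (hΘinj : Function.Injective Θ)
    (hΘcentral : ∀ h : C(K, ℝ), IsCentral (Θ h))
    (hΘsurj : ∀ S : D → D, IsCentral S → ∃ h : C(K, ℝ), Θ h = S)
    (hΘlat : ∀ (h h' : C(K, ℝ)) (f : D), 0 ≤ f → Θ (h ⊔ h') f = Θ h f ⊔ Θ h' f)
    (hΘnorm : ∀ h : C(K, ℝ), ‖h‖ =
      sInf {c : ℝ | 0 ≤ c ∧ ∀ f : D, 0 ≤ f → -(c • f) ≤ Θ h f ∧ Θ h f ≤ c • f})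
    -- the Arens homomorphism `m : C(K)'' → Z(E^{∼∼})`:
    (m : ((C(K, ℝ) →L[ℝ] ℝ) →L[ℝ] ℝ) → DD → DD)
    (hm : ∀ (F : (C(K, ℝ) →L[ℝ] ℝ) →L[ℝ] ℝ) (x'' : DD) (f : D) (μ : C(K, ℝ) →L[ℝ] ℝ),
      (∀ h : C(K, ℝ), μ h = pD x'' (Θ h f)) → pD (m F x'') f = F μ)
    -- `π` is the idempotent with `Z(E^{∼∼}) = π⬝C(K)''` and `Ker(m) = (1-π)⬝C(K)''`:
    (π : (C(K, ℝ) →L[ℝ] ℝ) →L[ℝ] ℝ)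
    (hπidem : arensMul C(K, ℝ) π π = π)
    (hπrange : {S : DD → DD | IsCentral S} =
      Set.range (fun F => m (arensMul C(K, ℝ) π F)))
    (hπker : {F : (C(K, ℝ) →L[ℝ] ℝ) →L[ℝ] ℝ | ∀ x'' : DD, m F x'' = 0} =
      Set.range (fun F => arensMul C(K, ℝ) (arensOne C(K, ℝ) - π) F))
    -- `p` is the band projection of `C(K)'` onto the band of order continuous
    -- functionals:
    (p : (C(K, ℝ) →L[ℝ] ℝ) →L[ℝ] ℝ)
    (hpidem : arensMul C(K, ℝ) p p = p)
    (hpproj : ∀ μ : C(K, ℝ) →L[ℝ] ℝ,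
      IsOrderContinuousFun ⇑(arensFDot C(K, ℝ) p μ) ∧
      ∀ ν : C(K, ℝ) →L[ℝ] ℝ, IsOrderContinuousFun ⇑ν →
        DualDisjoint (μ - arensFDot C(K, ℝ) p μ) ν) :
    -- `E^{∼∼} = (E^∼)ₙ^∼` iff `p = π`:
    (∀ x'' : DD, IsOrderContinuousFun (pD x'')) ↔ p = π := by
  have : IsOrderedAddMonoid E := { add_le_add_left := fun a b h c => add_le_add_left h c }
  have : IsOrderedAddMonoid D := { add_le_add_left := fun a b h c => add_le_add_left h c }
  have : IsOrderedAddMonoid DD := { add_le_add_left := fun a b h c => add_le_add_left h c }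
  have hΘ : IsCenterRep Θ :=
    ⟨hΘadd, hΘsmul, hΘmul, hΘone, hΘinj, hΘcentral, hΘsurj, hΘlat⟩
  have hone : ∀ μ, arensFDot C(K, ℝ) (arensOne C(K, ℝ)) μ = μ := fun μ => by
    ext a
    change μ (a * 1) = μ a
    rw [mul_one]
  have hπ : ∀ (x : DD) (f : D) (μ : C(K, ℝ) →L[ℝ] ℝ), (∀ h, μ h = pD x (Θ h f)) →
      (arensOne C(K, ℝ) - π) μ = 0 := by
    intro x f μ hμ
    have hker : arensOne C(K, ℝ) - π ∈ {F | ∀ x'' : DD, m F x'' = 0} := by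
      rw [hπker]
      refine ⟨arensOne C(K, ℝ), ?_⟩
      ext ν
      change (arensOne C(K, ℝ) - π) (arensFDot C(K, ℝ) (arensOne C(K, ℝ)) ν) = _
      rw [hone]
    rw [← hm _ x f μ hμ, hker x, hDD.map_zero_left]
  constructor
  · intro h
    have hcont : ∀ (x : DD) (f : D), IsOrderContinuousFun fun h => pD x (Θ h f) := fun x f =>
      hΘ.isOrderContinuousFun_orbit hD hDD (h x) f
    have hp : ∀ (x : DD) (f : D) (μ : C(K, ℝ) →L[ℝ] ℝ), (∀ h, μ h = pD x (Θ h f)) →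
        (arensOne C(K, ℝ) - p) μ = 0 := by
      intro x f μ hμ
      obtain ⟨h1, h2⟩ := hpproj μ
      have h3 : IsOrderContinuousFun ⇑(μ - arensFDot C(K, ℝ) p μ) :=
        (((hcont x f).congr hμ).sub h1).congr fun _ => rfl
      have h4 := congrArg (fun ν => ν 1) (eq_zero_of_dualDisjoint_self (h2 _ h3))
      have h5 : arensDot C(K, ℝ) μ 1 = μ := by
        ext a
        change μ (1 * a) = μ a
        rw [one_mul]
      change μ 1 - p (arensDot C(K, ℝ) μ 1) = 0 at h4
      rwa [h5] at h4
    obtain ⟨F, hF⟩ : arensOne C(K, ℝ) - p ∈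
        Set.range fun F => arensMul C(K, ℝ) (arensOne C(K, ℝ) - π) F := by
      rw [← hπker]
      intro x
      refine hDD.inj _ _ fun f => ?_
      obtain ⟨μ, hμ⟩ := hΘ.exists_orbitFunctional hDD x f
      rw [hm _ x f μ hμ, hp x f μ hμ, hDD.map_zero_left]
    have hπp : ∀ μ, π μ = π (arensFDot C(K, ℝ) p μ) := by
      intro μ
      set σ := arensFDot C(K, ℝ) F μ
      have h1 : μ - arensFDot C(K, ℝ) p μ = σ - arensFDot C(K, ℝ) π σ := by
        ext a
        have h2 := DFunLike.congr_fun hF (arensDot C(K, ℝ) μ a)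
        have h3 : arensFDot C(K, ℝ) F (arensDot C(K, ℝ) μ a) = arensDot C(K, ℝ) σ a := by
          ext b
          change F _ = F _
          congr 1
          ext c
          change μ (a * (b * c)) = μ (a * b * c)
          rw [mul_assoc]
        change (arensOne C(K, ℝ) - π) (arensFDot C(K, ℝ) F (arensDot C(K, ℝ) μ a)) = _ at h2
        rw [h3] at h2
        change σ (a * 1) - _ = μ (a * 1) - _ at h2
        rw [mul_one] at h2
        exact h2.symm
      have h4 : π (arensFDot C(K, ℝ) π σ) = π σ := DFunLike.congr_fun hπidem σ
      rw [← sub_eq_zero, ← map_sub, h1, map_sub, h4, sub_self]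
    ext μ
    have h1 := hΘ.apply_eq_zero_of_isOrderContinuousFun hD hDD hcont hπ (hpproj μ).1
    have h2 : p (arensDot C(K, ℝ) μ 1) = p μ := by
      congr 1
      ext a
      change μ (1 * a) = μ a
      rw [one_mul]
    change p (arensDot C(K, ℝ) μ 1) - π (arensFDot C(K, ℝ) p μ) = 0 at h1
    rw [h2, ← hπp μ] at h1
    exact sub_eq_zero.1 h1
  · rintro rfl x
    refine hΘ.isOrderContinuousFun_of_orbit hD hDD (fun x f => ?_) x
    obtain ⟨μ, hμ⟩ := hΘ.exists_orbitFunctional hDD x f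
    refine (hpproj μ).1.congr fun a => ?_
    have h1 := hπ x (Θ a f) (arensDot C(K, ℝ) μ a) fun b => by
      change μ (a * b) = _
      rw [hμ, mul_comm, hΘ.mul]
    change μ (a * 1) - p (arensDot C(K, ℝ) μ a) = 0 at h1
    rw [mul_one, hμ, sub_eq_zero] at h1
    exact h1
end

section
/- Every σ-Dedekind complete Riesz space E with point separating order dual has a topologically full center; in fact, for each x ∈ E_+ the set Z(E)x is itself equal to the order ideal generated by x (since each positive element generates a projection band). -/
section RieszSpace

set_option linter.unusedSectionVars false

open Set

variable {E : Type*} [Lattice E] [AddCommGroup E] [Module ℝ E] [IsOrderedAddMonoid E]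
  [PosSMulMono ℝ E]

/-- A positively homogeneous additive map on the positive cone extends to a linear map. -/
lemma exists_linearMap_eq_of_additive_on_nonneg (f : E → E)
    (hadd : ∀ z w : E, 0 ≤ z → 0 ≤ w → f (z + w) = f z + f w)
    (hsmul : ∀ (c : ℝ) (z : E), 0 < c → 0 ≤ z → f (c • z) = c • f z) :
    ∃ L : E →ₗ[ℝ] E, ∀ z : E, 0 ≤ z → L z = f z := by
  have key : ∀ a b c d : E, 0 ≤ a → 0 ≤ b → 0 ≤ c → 0 ≤ d → a - b = c - d →
      f a - f b = f c - f d := by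
    intro a b c d ha hb hc hd h
    have h1 : a + d = c + b := sub_eq_sub_iff_add_eq_add.mp h
    have h2 := congrArg f h1
    rw [hadd a d ha hd, hadd c b hc hb] at h2
    exact sub_eq_sub_iff_add_eq_add.mpr h2
  have f0 : f 0 = 0 := by
    have := hadd 0 0 le_rfl le_rfl
    simpa using this
  have hpos : ∀ (c : ℝ) (z : E), 0 < c → f (c • z)⁺ - f (c • z)⁻ = c • (f z⁺ - f z⁻) := by
    intro c z hc
    rw [smul_sub, ← hsmul c _ hc (posPart_nonneg z), ← hsmul c _ hc (negPart_nonneg z)]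
    refine key _ _ _ _ (posPart_nonneg _) (negPart_nonneg _)
      (smul_nonneg hc.le (posPart_nonneg z)) (smul_nonneg hc.le (negPart_nonneg z)) ?_
    rw [← smul_sub, posPart_sub_negPart, posPart_sub_negPart]
  refine ⟨{ toFun := fun z => f z⁺ - f z⁻, map_add' := ?_, map_smul' := ?_ }, ?_⟩
  · intro z w
    have h : f z⁺ - f z⁻ + (f w⁺ - f w⁻) = f (z⁺ + w⁺) - f (z⁻ + w⁻) := by
      rw [hadd _ _ (posPart_nonneg z) (posPart_nonneg w),
        hadd _ _ (negPart_nonneg z) (negPart_nonneg w)]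
      abel
    rw [h]
    refine key _ _ _ _ (posPart_nonneg _) (negPart_nonneg _)
      (add_nonneg (posPart_nonneg z) (posPart_nonneg w))
      (add_nonneg (negPart_nonneg z) (negPart_nonneg w)) ?_
    rw [add_sub_add_comm, posPart_sub_negPart, posPart_sub_negPart, posPart_sub_negPart]
  · intro c z
    simp only [RingHom.id_apply]
    rcases lt_trichotomy c 0 with hc | rfl | hc
    · have h := hpos (-c) z (neg_pos.mpr hc)
      rw [neg_smul, neg_smul, posPart_neg, negPart_neg] at h
      rw [← neg_sub, h, neg_neg]
    · simp [f0]
    · exact hpos c z hc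
  · intro z hz
    simp [posPart_of_nonneg hz, negPart_of_nonneg hz, f0]

/-- A linear map lying between `0` and the identity belongs to the ideal center. -/
lemma isCentral_of_nonneg_of_le_s19 (L : E →ₗ[ℝ] E) (h0 : ∀ z : E, 0 ≤ z → 0 ≤ L z)
    (h1 : ∀ z : E, 0 ≤ z → L z ≤ z) : IsCentral (L : E → E) := by
  have habs : ∀ z : E, |L z| ≤ |z| := by
    intro z
    have hmono : ∀ a b : E, a ≤ b → L a ≤ L b := fun a b hab => by
      have := h0 (b - a) (sub_nonneg.mpr hab)
      rwa [map_sub, sub_nonneg] at this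
    refine (abs_le'.mpr ⟨hmono _ _ (le_abs_self z), ?_⟩).trans (h1 _ (abs_nonneg z))
    rw [← map_neg]
    exact hmono _ _ (neg_le_abs z)
  refine ⟨⟨⟨L.map_add, L.map_smul⟩, ?_, ?_⟩, 1, ?_⟩
  · intro a b
    refine ⟨-(|a| + |b|), |a| + |b|, fun z haz hzb => ?_⟩
    have hz : |z| ≤ |a| + |b| := by
      refine abs_le'.mpr ⟨?_, ?_⟩
      · exact (hzb.trans (le_abs_self b)).trans (le_add_of_nonneg_left (abs_nonneg a))
      · exact ((neg_le_neg haz).trans (neg_le_abs a)).trans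
          (le_add_of_nonneg_right (abs_nonneg b))
    have h := (habs z).trans hz
    exact ⟨neg_le.mp ((neg_le_abs _).trans h), (le_abs_self _).trans h⟩
  · intro z w hzw
    refine le_antisymm ?_ (le_inf (abs_nonneg _) (abs_nonneg _))
    rw [← hzw]
    exact inf_le_inf_right _ (habs z)
  · intro z hz
    rw [one_smul]
    exact ⟨(neg_nonpos.mpr hz).trans (h0 z hz), h1 z hz⟩

lemma add_inf_le_inf_add_inf {z w u : E} (hz : 0 ≤ z) (hw : 0 ≤ w) (hu : 0 ≤ u) :
    (z + w) ⊓ u ≤ z ⊓ u + w ⊓ u := by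
  rw [inf_add, add_inf, add_inf]
  refine le_inf (le_inf inf_le_left ?_) (le_inf ?_ ?_)
  · exact inf_le_right.trans (le_add_of_nonneg_left hz)
  · exact inf_le_right.trans (le_add_of_nonneg_right hw)
  · exact inf_le_right.trans (le_add_of_nonneg_right hu)

/-- A σ-Dedekind complete Riesz space is Archimedean. -/
lemma nonpos_of_forall_nsmul_le
    (hσ : ∀ s : Set E, s.Nonempty → s.Countable → BddAbove s → ∃ b : E, IsLUB s b)
    {h x : E} (hx : ∀ n : ℕ, (n + 1) • h ≤ x) : h ≤ 0 := by
  obtain ⟨s, hs⟩ := hσ (range fun n : ℕ => (n + 1) • h) (range_nonempty _) (countable_range _)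
    ⟨x, by rintro _ ⟨n, rfl⟩; exact hx n⟩
  have hle : s ≤ s - h := hs.2 <| by
    rintro _ ⟨n, rfl⟩
    have := hs.1 ⟨n + 1, rfl⟩
    rw [le_sub_iff_add_le]
    simpa [succ_nsmul] using this
  simpa using hle

/-- `P` is the band projection onto the band generated by `u`. -/
def IsPrincipalProjection (u : E) (P : E →ₗ[ℝ] E) : Prop :=
  ∀ z : E, 0 ≤ z → IsLUB (range fun n : ℕ => z ⊓ n • u) (P z)

/-- In a σ-Dedekind complete Riesz space each positive element generates a projection band. -/
lemma exists_isPrincipalProjection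
    (hσ : ∀ s : Set E, s.Nonempty → s.Countable → BddAbove s → ∃ b : E, IsLUB s b)
    {u : E} (hu : 0 ≤ u) : ∃ P : E →ₗ[ℝ] E, IsPrincipalProjection u P := by
  have hex : ∀ z : E, ∃ p : E, IsLUB (range fun n : ℕ => z ⊓ n • u) p := fun z =>
    hσ _ (range_nonempty _) (countable_range _)
      ⟨z, by rintro _ ⟨n, rfl⟩; exact inf_le_left⟩
  choose f hf using hex
  have hle : ∀ (z : E) (n : ℕ), z ⊓ n • u ≤ f z := fun z n => (hf z).1 ⟨n, rfl⟩
  have hsub : ∀ (c : ℝ) (z : E), 0 < c → f (c • z) ≤ c • f z := by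
    intro c z hc
    refine (hf _).2 ?_
    rintro _ ⟨n, rfl⟩
    obtain ⟨m, hm⟩ := exists_nat_ge (c⁻¹ * n)
    have h1 : c⁻¹ • ((c • z) ⊓ n • u) ≤ z ⊓ m • u := by
      refine le_inf ?_ ?_
      · refine (smul_le_smul_of_nonneg_left inf_le_left (inv_nonneg.mpr hc.le)).trans_eq ?_
        rw [inv_smul_smul₀ hc.ne']
      · refine (smul_le_smul_of_nonneg_left inf_le_right (inv_nonneg.mpr hc.le)).trans ?_
        rw [← Nat.cast_smul_eq_nsmul ℝ n, ← Nat.cast_smul_eq_nsmul ℝ m, smul_smul,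
          ← sub_nonneg, ← sub_smul]
        exact smul_nonneg (sub_nonneg.mpr hm) hu
    have h2 := smul_le_smul_of_nonneg_left (h1.trans (hle z m)) hc.le
    rwa [smul_inv_smul₀ hc.ne'] at h2
  have hadd : ∀ z w : E, 0 ≤ z → 0 ≤ w → f (z + w) = f z + f w := by
    intro z w hz hw
    refine le_antisymm ((hf _).2 ?_) ?_
    · rintro _ ⟨n, rfl⟩
      exact (add_inf_le_inf_add_inf hz hw (nsmul_nonneg hu n)).trans
        (add_le_add (hle z n) (hle w n))
    · rw [← le_sub_iff_add_le]
      refine (hf z).2 ?_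
      rintro _ ⟨n, rfl⟩
      rw [le_sub_iff_add_le, ← le_sub_iff_add_le']
      refine (hf w).2 ?_
      rintro _ ⟨m, rfl⟩
      rw [le_sub_iff_add_le']
      refine le_trans (le_inf (add_le_add inf_le_left inf_le_left) ?_) (hle (z + w) (n + m))
      rw [add_nsmul]
      exact add_le_add inf_le_right inf_le_right
  have hsmul : ∀ (c : ℝ) (z : E), 0 < c → 0 ≤ z → f (c • z) = c • f z := by
    intro c z hc _
    refine le_antisymm (hsub c z hc) ?_
    have h := smul_le_smul_of_nonneg_left (hsub c⁻¹ (c • z) (inv_pos.mpr hc)) hc.le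
    rwa [inv_smul_smul₀ hc.ne', smul_inv_smul₀ hc.ne'] at h
  obtain ⟨P, hP⟩ := exists_linearMap_eq_of_additive_on_nonneg f hadd hsmul
  exact ⟨P, fun z hz => by rw [hP z hz]; exact hf z⟩

namespace IsPrincipalProjection

variable {u v : E} {P Q : E →ₗ[ℝ] E}

lemma inf_nsmul_le (hP : IsPrincipalProjection u P) {z : E} (hz : 0 ≤ z) (n : ℕ) :
    z ⊓ n • u ≤ P z :=
  (hP z hz).1 ⟨n, rfl⟩

lemma nonneg (hP : IsPrincipalProjection u P) {z : E} (hz : 0 ≤ z) : 0 ≤ P z := by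
  have := hP.inf_nsmul_le hz 0
  rwa [zero_nsmul, inf_eq_right.mpr hz] at this

lemma apply_le (hP : IsPrincipalProjection u P) {z : E} (hz : 0 ≤ z) : P z ≤ z :=
  (hP z hz).2 <| by rintro _ ⟨n, rfl⟩; exact inf_le_left

lemma mono (hP : IsPrincipalProjection u P) {z w : E} (h : z ≤ w) : P z ≤ P w := by
  have := hP.nonneg (sub_nonneg.mpr h)
  rwa [map_sub, sub_nonneg] at this

lemma apply_self (hP : IsPrincipalProjection u P) (hu : 0 ≤ u) : P u = u := by
  refine le_antisymm (hP.apply_le hu) ?_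
  simpa using hP.inf_nsmul_le hu 1

lemma apply_eq_zero_of_inf_eq_zero (hP : IsPrincipalProjection u P) (hu : 0 ≤ u) {z : E}
    (hz : 0 ≤ z) (h : z ⊓ u = 0) : P z = 0 := by
  refine le_antisymm ((hP z hz).2 ?_) (hP.nonneg hz)
  rintro _ ⟨n, rfl⟩
  induction n with
  | zero => simp [hz]
  | succ n ih =>
    have h1 : z ⊓ (n + 1) • u ≤ z ⊓ n • u + z ⊓ u := by
      rw [add_inf, succ_nsmul]
      refine le_inf ?_ ?_
      · exact inf_le_left.trans (le_add_of_nonneg_left (le_inf hz (nsmul_nonneg hu n)))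
      · rw [inf_add]
        exact inf_le_inf_right _ (le_add_of_nonneg_right hu)
    rw [h, add_zero] at h1
    exact h1.trans ih

lemma ext_nonneg (h : ∀ z : E, 0 ≤ z → P z = Q z) (z : E) : P z = Q z := by
  rw [← posPart_sub_negPart z, map_sub, map_sub, h _ (posPart_nonneg z),
    h _ (negPart_nonneg z)]

lemma apply_apply_left (hP : IsPrincipalProjection u P) (hQ : IsPrincipalProjection v Q)
    (huv : u ≤ v) (z : E) : P (Q z) = P z := by
  refine ext_nonneg (P := P ∘ₗ Q) (fun z hz => le_antisymm (hP.mono (hQ.apply_le hz)) ?_) z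
  refine (hP z hz).2 ?_
  rintro _ ⟨n, rfl⟩
  refine le_trans (le_inf ?_ inf_le_right) (hP.inf_nsmul_le (hQ.nonneg hz) n)
  exact (inf_le_inf_left z (nsmul_le_nsmul_right huv n)).trans (hQ.inf_nsmul_le hz n)

lemma apply_apply_right (hP : IsPrincipalProjection u P) (hQ : IsPrincipalProjection v Q)
    (huv : u ≤ v) (z : E) : Q (P z) = P z := by
  refine ext_nonneg (P := Q ∘ₗ P)
    (fun z hz => le_antisymm (hQ.apply_le (hP.nonneg hz)) ?_) z
  refine (hP z hz).2 ?_
  rintro _ ⟨n, rfl⟩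
  refine le_trans (le_inf (hP.inf_nsmul_le hz n) ?_) (hQ.inf_nsmul_le (hP.nonneg hz) n)
  exact inf_le_right.trans (nsmul_le_nsmul_right huv n)

lemma apply_eq_posPart {w : E} (hP : IsPrincipalProjection w⁺ P) : P w = w⁺ := by
  conv_lhs => rw [← posPart_sub_negPart w]
  rw [map_sub, hP.apply_self (posPart_nonneg w),
    hP.apply_eq_zero_of_inf_eq_zero (posPart_nonneg w) (negPart_nonneg w), sub_zero]
  rw [inf_comm]
  exact posPart_inf_negPart_eq_zero w

/-- If `t` dominates both `q • Q z` and `r • P z`, where `P ≤ Q`, it dominates their join. -/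
lemma smul_sub_add_smul_le (hP : IsPrincipalProjection u P) (hQ : IsPrincipalProjection v Q)
    (huv : u ≤ v) {q r : ℝ} {z t : E} (hq : q • Q z ≤ t) (hr : r • P z ≤ t) :
    q • (Q z - P z) + r • P z ≤ t := by
  have h1 := hP.mono hr
  have h2 := hP.apply_le (sub_nonneg.mpr hq)
  rw [map_smul, hP.apply_apply_left hP le_rfl] at h1
  rw [map_sub, map_smul, hP.apply_apply_left hQ huv] at h2
  rw [← sub_nonneg] at h1 h2 ⊢
  refine (add_nonneg h1 h2).trans_eq ?_
  module

end IsPrincipalProjection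

/-- A family of band projections onto the bands generated by `(y - q • x)⁺`, `q ∈ ℝ`. -/
def IsSpectralSystem (x y : E) (P : ℝ → E →ₗ[ℝ] E) : Prop :=
  ∀ q : ℝ, IsPrincipalProjection (y - q • x)⁺ (P q)

namespace IsSpectralSystem

variable {x y : E} {P : ℝ → E →ₗ[ℝ] E}

lemma posPart_anti (hx : 0 ≤ x) {q r : ℝ} (h : q ≤ r) : (y - r • x)⁺ ≤ (y - q • x)⁺ := by
  refine posPart_mono (sub_le_sub_left ?_ y)
  rw [← sub_nonneg, ← sub_smul]
  exact smul_nonneg (sub_nonneg.mpr h) hx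

lemma smul_apply_le (hP : IsSpectralSystem x y P) (hx : 0 ≤ x) (hyx : y ≤ x) {q : ℝ}
    (hq : 0 ≤ q) {z : E} (hz : 0 ≤ z) : q • P q z ≤ z := by
  rcases le_or_gt q 1 with h | h
  · refine (smul_le_smul_of_nonneg_left ((hP q).apply_le hz) hq).trans ?_
    rw [← sub_nonneg]
    have := smul_nonneg (sub_nonneg.mpr h) hz
    rwa [sub_smul, one_smul] at this
  · have hu : (y - q • x)⁺ = 0 := by
      refine le_antisymm ((posPart_anti hx h.le).trans ?_) (posPart_nonneg _)
      rw [one_smul, posPart_of_nonpos (sub_nonpos.mpr hyx)]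
    rw [(hP q).apply_eq_zero_of_inf_eq_zero (posPart_nonneg _) hz, smul_zero]
    · exact hz
    · rw [hu, inf_eq_right.mpr hz]

lemma smul_apply_self_le (hP : IsSpectralSystem x y P) (hy : 0 ≤ y) (q : ℝ) :
    q • P q x ≤ y := by
  have h := (hP q).apply_eq_posPart.ge.trans' (posPart_nonneg _)
  rw [map_sub, map_smul, sub_nonneg] at h
  exact h.trans ((hP q).apply_le hy)

/-- A common upper bound of the elements `q • P q x` dominates `y`, up to `x / (N + 1)`. -/
lemma le_add_smul (hP : IsSpectralSystem x y P) (hx : 0 ≤ x) (hy : 0 ≤ y) (hyx : y ≤ x)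
    {b : E} (hb : ∀ q : ℚ≥0, (q : ℝ) • P q x ≤ b) (N : ℕ) :
    y ≤ b + (1 / (N + 1) : ℝ) • x := by
  have hN : (0 : ℝ) < N + 1 := by positivity
  set δ : ℝ := 1 / (N + 1) with hδ
  have hδ0 : 0 ≤ δ := by positivity
  set w : E := y - b - δ • x with hw
  have hb0 : 0 ≤ b := by simpa using hb 0
  have step : ∀ k : ℕ, w ≤ P (k * δ) w := by
    intro k
    induction k with
    | zero =>
      have hle : w ≤ y := by
        rw [hw, sub_sub]
        exact sub_le_self _ (add_nonneg hb0 (smul_nonneg hδ0 hx))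
      have h0 := hP 0
      have hyy : P 0 y = y := by
        have := h0.apply_eq_posPart
        rwa [zero_smul, sub_zero, posPart_of_nonneg hy] at this
      have h1 := h0.apply_le (sub_nonneg.mpr hle)
      rw [map_sub, hyy, sub_le_sub_iff_left] at h1
      simpa using h1
    | succ k ih =>
      set q : ℝ := k * δ with hq
      set r : ℝ := ((k + 1 : ℕ) : ℝ) * δ with hr
      have hrq : r = q + δ := by rw [hr, hq]; push_cast; ring
      have hqr : q ≤ r := by linarith
      have hle := posPart_anti (y := y) hx hqr
      have hqx : q • P q x ≤ P q b := by
        have h := (hP q).mono (hb ((k : ℚ≥0) * (1 / (N + 1))))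
        have hc : (((k : ℚ≥0) * (1 / (N + 1)) : ℚ≥0) : ℝ) = q := by
          rw [hq, hδ]; push_cast; ring
        rw [hc, map_smul, (hP q).apply_apply_left (hP q) le_rfl] at h
        exact h
      have hPqw : P q w ≤ P q (y - r • x) := by
        rw [← sub_nonneg] at hqx ⊢
        refine hqx.trans_eq ?_
        simp only [hw, hrq, map_sub, map_smul]
        module
      have hsub : P q w - P r w ≤ P q (y - r • x) - P r (y - r • x) := by
        have h := (hP r).apply_le (sub_nonneg.mpr hPqw)
        rw [← map_sub, (hP r).apply_apply_left (hP q) hle] at h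
        rw [← sub_nonneg] at h ⊢
        refine h.trans_eq ?_
        simp only [map_sub]
        abel
      have hneg : P q (y - r • x) - P r (y - r • x) ≤ 0 := by
        have h := (hP q).mono (le_posPart (y - r • x))
        rw [← (hP r).apply_eq_posPart, (hP r).apply_apply_right (hP q) hle] at h
        exact sub_nonpos.mpr h
      exact ih.trans (sub_nonpos.mp (hsub.trans hneg))
  have h1 := step (N + 1)
  have hone : ((N + 1 : ℕ) : ℝ) * δ = 1 := by rw [hδ]; push_cast; field_simp
  have hu : (y - (1 : ℝ) • x)⁺ = 0 := by
    rw [one_smul, posPart_of_nonpos (sub_nonpos.mpr hyx)]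
  have hz : ∀ z : E, 0 ≤ z → P 1 z = 0 := fun z hz =>
    (hP 1).apply_eq_zero_of_inf_eq_zero (posPart_nonneg _) hz (by rw [hu, inf_eq_right.mpr hz])
  rw [hone, ← posPart_sub_negPart w, map_sub, hz _ (posPart_nonneg w), hz _ (negPart_nonneg w),
    sub_zero, posPart_sub_negPart, hw, sub_sub, sub_nonpos] at h1
  exact h1

end IsSpectralSystem

/-- In a σ-Dedekind complete Riesz space, `0 ≤ y ≤ x` implies `y = T x` for a central `T`. -/
lemma exists_isCentral_apply_eq
    (hσ : ∀ s : Set E, s.Nonempty → s.Countable → BddAbove s → ∃ b : E, IsLUB s b)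
    {x y : E} (hy : 0 ≤ y) (hyx : y ≤ x) : ∃ T : E → E, IsCentral T ∧ T x = y := by
  have hx := hy.trans hyx
  choose P hP' using fun q : ℝ =>
    exists_isPrincipalProjection hσ (posPart_nonneg (y - q • x))
  have hP : IsSpectralSystem x y P := hP'
  have hex : ∀ z : E, ∃ t : E, 0 ≤ z → IsLUB (range fun q : ℚ≥0 => (q : ℝ) • P q z) t := by
    intro z
    by_cases hz : 0 ≤ z
    · obtain ⟨t, ht⟩ := hσ (range fun q : ℚ≥0 => (q : ℝ) • P q z) (range_nonempty _)
        (countable_range _)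
        ⟨z, by rintro _ ⟨q, rfl⟩; exact hP.smul_apply_le hx hyx q.cast_nonneg hz⟩
      exact ⟨t, fun _ => ht⟩
    · exact ⟨0, fun h => absurd h hz⟩
  choose f hf using hex
  have hle : ∀ z : E, 0 ≤ z → ∀ q : ℚ≥0, (q : ℝ) • P q z ≤ f z := fun z hz q =>
    (hf z hz).1 ⟨q, rfl⟩
  have hsub : ∀ (c : ℝ) (z : E), 0 < c → 0 ≤ z → f (c • z) ≤ c • f z := by
    intro c z hc hz
    refine (hf _ (smul_nonneg hc.le hz)).2 ?_
    rintro _ ⟨q, rfl⟩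
    have h := smul_le_smul_of_nonneg_left (hle z hz q) hc.le
    simpa only [map_smul, smul_comm c] using h
  have hjoin : ∀ (z w : E), 0 ≤ z → 0 ≤ w → ∀ q r : ℚ≥0, q ≤ r →
      (q : ℝ) • P q z + (r : ℝ) • P r w ≤ f (z + w) := by
    intro z w hz hw q r hqr
    have hqr' : (q : ℝ) ≤ r := by exact_mod_cast hqr
    have hu := IsSpectralSystem.posPart_anti (y := y) hx hqr'
    refine le_trans ?_ ((hP r).smul_sub_add_smul_le (hP q) hu
      (hle _ (add_nonneg hz hw) q) (hle _ (add_nonneg hz hw) r))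
    have h1 : 0 ≤ P q w - P r w := by
      have := (hP r).apply_le ((hP q).nonneg hw)
      rwa [(hP r).apply_apply_left (hP q) hu, ← sub_nonneg] at this
    have h2 := smul_nonneg (q.cast_nonneg (α := ℝ)) h1
    have h3 := smul_nonneg (sub_nonneg.mpr hqr') ((hP r).nonneg hz)
    rw [← sub_nonneg]
    refine (add_nonneg h2 h3).trans_eq ?_
    simp only [map_add]
    module
  have hadd : ∀ z w : E, 0 ≤ z → 0 ≤ w → f (z + w) = f z + f w := by
    intro z w hz hw
    refine le_antisymm ((hf _ (add_nonneg hz hw)).2 ?_) ?_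
    · rintro _ ⟨q, rfl⟩
      simp only [map_add, smul_add]
      exact add_le_add (hle z hz q) (hle w hw q)
    · rw [← le_sub_iff_add_le]
      refine (hf z hz).2 ?_
      rintro _ ⟨q, rfl⟩
      rw [le_sub_iff_add_le, ← le_sub_iff_add_le']
      refine (hf w hw).2 ?_
      rintro _ ⟨r, rfl⟩
      rw [le_sub_iff_add_le']
      rcases le_total q r with h | h
      · exact hjoin z w hz hw q r h
      · rw [add_comm, add_comm z]
        exact hjoin w z hw hz r q h
  have hsmul : ∀ (c : ℝ) (z : E), 0 < c → 0 ≤ z → f (c • z) = c • f z := by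
    intro c z hc hz
    refine le_antisymm (hsub c z hc hz) ?_
    have h := smul_le_smul_of_nonneg_left
      (hsub c⁻¹ (c • z) (inv_pos.mpr hc) (smul_nonneg hc.le hz)) hc.le
    rwa [inv_smul_smul₀ hc.ne', smul_inv_smul₀ hc.ne'] at h
  obtain ⟨L, hL⟩ := exists_linearMap_eq_of_additive_on_nonneg f hadd hsmul
  refine ⟨L, isCentral_of_nonneg_of_le_s19 L (fun z hz => ?_) (fun z hz => ?_), ?_⟩
  · rw [hL z hz]
    simpa using hle z hz 0
  · rw [hL z hz]
    refine (hf z hz).2 ?_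
    rintro _ ⟨q, rfl⟩
    exact hP.smul_apply_le hx hyx q.cast_nonneg hz
  · rw [hL x hx]
    refine le_antisymm ((hf x hx).2 ?_) ?_
    · rintro _ ⟨q, rfl⟩
      exact hP.smul_apply_self_le hy q
    · rw [← sub_nonpos]
      refine nonpos_of_forall_nsmul_le hσ (x := x) fun N => ?_
      have hN : (0 : ℝ) < N + 1 := by positivity
      have h := sub_le_iff_le_add'.mpr (hP.le_add_smul hx hy hyx (hle x hx) N)
      have h' := smul_le_smul_of_nonneg_left h hN.le
      rw [smul_smul, mul_one_div_cancel hN.ne', one_smul] at h'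
      rw [← Nat.cast_smul_eq_nsmul ℝ]
      exact_mod_cast h'

end RieszSpace

/-- σ-Dedekind complete spaces.  Every σ-Dedekind complete Riesz space
`E` with point separating order dual (realized as `D`) has a topologically full center;
in fact, for each `x ∈ E₊` the set `Z(E)x` is itself equal to the order ideal generated
by `x`. -/
theorem statement19
    {E D Z : Type*}
    [Lattice E] [AddCommGroup E] [Module ℝ E]
    [CovariantClass E E (· + ·) (· ≤ ·)] [PosSMulMono ℝ E]
    [Lattice D] [AddCommGroup D] [Module ℝ D]
    [CovariantClass D D (· + ·) (· ≤ ·)] [PosSMulMono ℝ D]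
    [Lattice Z] [NormedRing Z] [NormedAlgebra ℝ Z]
    [CovariantClass Z Z (· + ·) (· ≤ ·)] [PosSMulMono ℝ Z]
    (pE : D → E → ℝ) (hD : IsOrderDual E D pE) (hsep : SepPoints pE)
    (ρ : Z → E → E) (hZ : IsCenterOf E Z ρ)
    -- `E` is σ-Dedekind complete:
    (hσ : ∀ s : Set E, s.Nonempty → s.Countable → BddAbove s → ∃ b : E, IsLUB s b) :
    -- `E` has a topologically full center …
    TopFullCenter pE ρ ∧
    -- … and in fact `Z(E)x` equals the order ideal generated by `x` for every `x ∈ E₊`: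
    ∀ x : E, 0 ≤ x →
      {y : E | ∃ c : ℝ, 0 ≤ c ∧ |y| ≤ c • x} = {y : E | ∃ T : Z, ρ T x = y} := by
  have : IsOrderedAddMonoid E :=
    { add_le_add_left := fun a b h c => by
        rw [add_comm a, add_comm b]
        exact CovariantClass.elim c h }
  have key : ∀ x : E, 0 ≤ x → ∀ y : E, (∃ c : ℝ, 0 ≤ c ∧ |y| ≤ c • x) → ∃ T : Z, ρ T x = y := by
    rintro x hx y ⟨c, hc, hyc⟩
    have hpos : ∀ v : E, 0 ≤ v → v ≤ c • x → ∃ T : Z, ρ T x = v := by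
      intro v hv hvx
      have hc1 : 0 < c + 1 := by positivity
      have hle : (c + 1)⁻¹ • v ≤ x := by
        have h : v ≤ (c + 1) • x := by
          rw [add_smul, one_smul]
          exact hvx.trans (le_add_of_nonneg_right hx)
        have h' := smul_le_smul_of_nonneg_left h (inv_nonneg.mpr hc1.le)
        rwa [inv_smul_smul₀ hc1.ne'] at h'
      obtain ⟨S, hS, hSx⟩ := exists_isCentral_apply_eq hσ
        (smul_nonneg (inv_nonneg.mpr hc1.le) hv) hle
      obtain ⟨T, hT⟩ := hZ.surj S hS
      refine ⟨(c + 1) • T, ?_⟩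
      rw [(hZ.lin_vec x).map_smul, hT, hSx, smul_inv_smul₀ hc1.ne']
    obtain ⟨T₁, h₁⟩ := hpos y⁺ (posPart_nonneg y) ((sup_le (le_abs_self y) (abs_nonneg y)).trans hyc)
    obtain ⟨T₂, h₂⟩ := hpos y⁻ (negPart_nonneg y) ((sup_le (neg_le_abs y) (abs_nonneg y)).trans hyc)
    exact ⟨T₁ - T₂, by rw [(hZ.lin_vec x).map_sub, h₁, h₂, posPart_sub_negPart]⟩
  refine ⟨fun x hx y hy fs ε hε => ⟨y, key x hx y hy, fun f _ => by simpa using hε⟩,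
    fun x hx => Set.Subset.antisymm (key x hx) ?_⟩
  rintro y ⟨T, rfl⟩
  obtain ⟨-, c, hc⟩ := hZ.central T
  obtain ⟨h1, h2⟩ := hc x hx
  have hmax : c • x ≤ max c 0 • x := by
    rw [← sub_nonneg, ← sub_smul]
    exact smul_nonneg (sub_nonneg.mpr (le_max_left c 0)) hx
  exact ⟨max c 0, le_max_right c 0, (abs_le'.mpr ⟨h2, neg_le.mp h1⟩).trans hmax⟩
end
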